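/- arXiv:1208.3505 — 4 statements merged into one kernel-verified Lean document; each statement's English description precedes it below -/
import Mathlib

section
/- Let u be an aperiodic recurrent renewal sequence with lifetime distribution f. If limsup_{N→∞} N·c(N)/L(N) < 1/(√5+1), then u is smooth, i.e. ∑_{k=1}^{n} |u(k) − u(k+1)| = o(a(n)) as n → ∞. -/
open Filter Finset

/-- `rnwC f N = ∑_{n ≥ N} f n`, the tail of the lifetime distribution. -/
noncomputable def rnwC (f : ℕ → ℝ) (N : ℕ) : ℝ := ∑' k : ℕ, f (N + k)

/-- `rnwL f N = ∑_{k=1}^{N} c(k)`. -/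
noncomputable def rnwL (f : ℕ → ℝ) (N : ℕ) : ℝ := ∑ k ∈ Finset.Icc 1 N, rnwC f k

/-- `rnwA u n = ∑_{k=1}^{n} u k`, the return sequence. -/
noncomputable def rnwA (u : ℕ → ℝ) (n : ℕ) : ℝ := ∑ k ∈ Finset.Icc 1 n, u k

section rnwaux
variable {f u : ℕ → ℝ}

theorem rnw_summ (hs : HasSum f 1) (N : ℕ) : Summable (fun k => f (N + k)) := by
  have := (summable_nat_add_iff N).2 hs.summable
  simpa [add_comm] using this

theorem rnwC_succ (hs : HasSum f 1) (N : ℕ) : rnwC f N = f N + rnwC f (N + 1) := by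
  unfold rnwC
  rw [(rnw_summ hs N).tsum_eq_zero_add]
  simp only [add_zero]
  congr 1
  apply tsum_congr
  intro k
  congr 1
  ring

theorem rnwC_nonneg (hp : ∀ n, 0 ≤ f n) (N : ℕ) : 0 ≤ rnwC f N :=
  tsum_nonneg fun _ => hp _

theorem rnwC_one (h0 : f 0 = 0) (hs : HasSum f 1) : rnwC f 1 = 1 := by
  have h := rnwC_succ hs 0
  have h2 : rnwC f 0 = 1 := by
    unfold rnwC
    simpa using hs.tsum_eq
  rw [h2, h0] at h
  simpa using h.symm

theorem rnwC_le (hp : ∀ n, 0 ≤ f n) (hs : HasSum f 1) (N : ℕ) : rnwC f (N + 1) ≤ rnwC f N := by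
  have := rnwC_succ hs N
  linarith [hp N]

theorem rnwL_succ (N : ℕ) : rnwL f (N + 1) = rnwL f N + rnwC f (N + 1) := by
  unfold rnwL
  rw [Finset.sum_Icc_succ_top (by omega)]

theorem rnwL_range (N : ℕ) : rnwL f N = ∑ k ∈ Finset.range N, rnwC f (k + 1) := by
  induction N with
  | zero => simp [rnwL]
  | succ n ih => rw [rnwL_succ, ih, Finset.sum_range_succ]

theorem rnwL_mono (hp : ∀ n, 0 ≤ f n) : Monotone (rnwL f) :=
  monotone_nat_of_le_succ fun n => by
    rw [rnwL_succ]; linarith [rnwC_nonneg hp (n + 1)]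

theorem rnwL_one (h0 : f 0 = 0) (hs : HasSum f 1) : rnwL f 1 = 1 := by
  simp [rnwL, rnwC_one h0 hs]

theorem rnwL_ge (h0 : f 0 = 0) (hp : ∀ n, 0 ≤ f n) (hs : HasSum f 1) (N : ℕ) (hN : 1 ≤ N) :
    1 ≤ rnwL f N := by
  rw [← rnwL_one h0 hs]; exact rnwL_mono hp hN

theorem rnw_NcL (hp : ∀ n, 0 ≤ f n) (hs : HasSum f 1) (N : ℕ) :
    (N : ℝ) * rnwC f N ≤ rnwL f N := by
  unfold rnwL
  have ha : Antitone (rnwC f) := antitone_nat_of_succ_le (rnwC_le hp hs)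
  have := Finset.card_nsmul_le_sum (Finset.Icc 1 N) (rnwC f) (rnwC f N)
    (fun k hk => ha (Finset.mem_Icc.1 hk).2)
  simpa using this

theorem rnw_ev (h0 : f 0 = 0) (hp : ∀ n, 0 ≤ f n) (hs : HasSum f 1)
    (hlim : Filter.limsup (fun N : ℕ => (N : ℝ) * rnwC f N / rnwL f N) Filter.atTop
      < 1 / (Real.sqrt 5 + 1)) :
    ∃ N0 : ℕ, 1 ≤ N0 ∧ ∀ N, N0 ≤ N → (N : ℝ) * rnwC f N ≤ 31 / 100 * rnwL f N := by
  have h5 : (2.23 : ℝ) < Real.sqrt 5 := by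
    apply Real.lt_sqrt_of_sq_lt; norm_num
  have h6 : 1 / (Real.sqrt 5 + 1) < (31 / 100 : ℝ) := by
    rw [div_lt_iff₀ (by linarith)]; linarith
  have hb : Filter.IsBoundedUnder (· ≤ ·) Filter.atTop
      (fun N : ℕ => (N : ℝ) * rnwC f N / rnwL f N) := by
    refine Filter.isBoundedUnder_of ⟨1, fun N => ?_⟩
    have hl : 0 ≤ rnwL f N := Finset.sum_nonneg fun _ _ => rnwC_nonneg hp _
    exact div_le_one_of_le₀ (rnw_NcL hp hs N) hl
  have := Filter.eventually_lt_of_limsup_lt (hlim.trans h6) hb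
  obtain ⟨N0, h⟩ := Filter.eventually_atTop.1 this
  refine ⟨max N0 1, le_max_right _ _, fun N hN => ?_⟩
  have h1 := h N (le_trans (le_max_left _ _) hN)
  have h2 := rnwL_ge h0 hp hs N (le_trans (le_max_right _ _) hN)
  rw [div_lt_iff₀ (by linarith)] at h1
  exact h1.le

/-- growth of L -/
theorem rnwL_cube (h0 : f 0 = 0) (hp : ∀ n, 0 ≤ f n) (hs : HasSum f 1) {N0 : ℕ} (hN0 : 1 ≤ N0)
    (h : ∀ N, N0 ≤ N → (N : ℝ) * rnwC f N ≤ 31 / 100 * rnwL f N) :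
    ∃ C : ℝ, 0 < C ∧ ∀ N, N0 ≤ N → rnwL f N ^ 3 ≤ C * N := by
  have hL0 := rnwL_ge h0 hp hs N0 hN0
  refine ⟨rnwL f N0 ^ 3, by positivity, fun N hN => ?_⟩
  induction N, hN using Nat.le_induction with
  | base =>
    have : (1 : ℝ) ≤ N0 := by exact_mod_cast hN0
    have h3 : 0 ≤ rnwL f N0 ^ 3 := by positivity
    nlinarith
  | succ n hn ih =>
    have h1 := h (n + 1) (by omega)
    have h2 := rnwL_succ (f := f) n
    have hL := rnwL_ge h0 hp hs (n + 1) (by omega)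
    have hL' := rnwL_ge h0 hp hs n (by omega)
    set x := rnwL f (n + 1)
    set y := rnwL f n
    set C := rnwL f N0 ^ 3
    have hn1 : (1 : ℝ) ≤ n := by exact_mod_cast hN0.trans hn
    push_cast at h1 ⊢
    set m : ℝ := (n : ℝ)
    have h4 : x * (m + 1 - 31 / 100) ≤ (m + 1) * y := by nlinarith
    have h5 : (x * (m + 1 - 31 / 100)) ^ 3 ≤ ((m + 1) * y) ^ 3 :=
      pow_le_pow_left₀ (mul_nonneg (by linarith) (by linarith)) h4 3
    have h6 : (m + 1) ^ 2 * m ≤ (m + 1 - 31 / 100) ^ 3 := by nlinarith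
    have h7 : ((m + 1) * y) ^ 3 ≤ (m + 1) ^ 3 * (C * m) := by
      rw [mul_pow]; gcongr
    have h8 : x ^ 3 * ((m + 1) ^ 2 * m) ≤ x ^ 3 * (m + 1 - 31 / 100) ^ 3 := by gcongr
    have h9 : x ^ 3 * ((m + 1) ^ 2 * m) ≤ (C * (m + 1)) * ((m + 1) ^ 2 * m) := by
      calc _ ≤ _ := h8
        _ = (x * (m + 1 - 31 / 100)) ^ 3 := by ring
        _ ≤ _ := h5.trans h7
        _ = _ := by ring
    exact le_of_mul_le_mul_right h9 (by positivity)

theorem rnw_u_nonneg (hp : ∀ n, 0 ≤ f n) (hu0 : u 0 = 1)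
    (hu : ∀ n, 1 ≤ n → u n = ∑ k ∈ Finset.Icc 1 n, f k * u (n - k)) (n : ℕ) : 0 ≤ u n := by
  induction n using Nat.strong_induction_on with
  | _ n ih =>
    rcases Nat.eq_zero_or_pos n with rfl | hn
    · rw [hu0]; norm_num
    · rw [hu n hn]
      refine Finset.sum_nonneg fun k hk => mul_nonneg (hp k) (ih _ ?_)
      have := Finset.mem_Icc.1 hk
      omega

theorem rnw_u_le (hp : ∀ n, 0 ≤ f n) (hs : HasSum f 1) (hu0 : u 0 = 1)
    (hu : ∀ n, 1 ≤ n → u n = ∑ k ∈ Finset.Icc 1 n, f k * u (n - k)) (n : ℕ) : u n ≤ 1 := by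
  induction n using Nat.strong_induction_on with
  | _ n ih =>
    rcases Nat.eq_zero_or_pos n with rfl | hn
    · rw [hu0]
    · rw [hu n hn]
      calc _ ≤ ∑ k ∈ Finset.Icc 1 n, f k := by
            refine Finset.sum_le_sum fun k hk => ?_
            have := Finset.mem_Icc.1 hk
            exact mul_le_of_le_one_right (hp k) (ih _ (by omega))
        _ ≤ 1 := sum_le_hasSum _ (fun i _ => hp i) hs

theorem rnw_u_range (hu : ∀ n, 1 ≤ n → u n = ∑ k ∈ Finset.Icc 1 n, f k * u (n - k)) (n : ℕ) :
    u (n + 1) = ∑ k ∈ Finset.range (n + 1), u k * f (n + 1 - k) := by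
  rw [hu (n + 1) (by omega)]
  refine Finset.sum_bij' (fun k _ => n + 1 - k) (fun k _ => n + 1 - k) ?_ ?_ ?_ ?_ ?_
  · intro k hk; simp only [Finset.mem_Icc] at hk; simp only [Finset.mem_range]; omega
  · intro k hk; simp only [Finset.mem_range] at hk; simp only [Finset.mem_Icc]; omega
  · intro k hk; simp only [Finset.mem_Icc] at hk; omega
  · intro k hk; simp only [Finset.mem_range] at hk; omega
  · intro k hk; simp only [Finset.mem_Icc] at hk
    rw [show n + 1 - (n + 1 - k) = k by omega, mul_comm]

theorem rnw_V (h0 : f 0 = 0) (hs : HasSum f 1) (hu0 : u 0 = 1)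
    (hu : ∀ n, 1 ≤ n → u n = ∑ k ∈ Finset.Icc 1 n, f k * u (n - k)) (n : ℕ) :
    ∑ k ∈ Finset.range (n + 1), u k * rnwC f (n + 1 - k) = 1 := by
  induction n with
  | zero => simp [hu0, rnwC_one h0 hs]
  | succ n ih =>
    rw [Finset.sum_range_succ, show n + 1 + 1 - (n + 1) = 1 by omega, rnwC_one h0 hs, mul_one,
      rnw_u_range hu n, ← Finset.sum_add_distrib, ← ih]
    refine Finset.sum_congr rfl fun k hk => ?_
    have := Finset.mem_range.1 hk
    rw [show n + 1 + 1 - k = (n + 1 - k) + 1 by omega, rnwC_succ hs (n + 1 - k)]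
    ring

theorem rnw_W (h0 : f 0 = 0) (hs : HasSum f 1) (hu0 : u 0 = 1)
    (hu : ∀ n, 1 ≤ n → u n = ∑ k ∈ Finset.Icc 1 n, f k * u (n - k)) (n : ℕ) :
    ∑ k ∈ Finset.range (n + 1), u k * rnwL f (n + 1 - k) = n + 1 := by
  induction n with
  | zero => simp [hu0, rnwL_one h0 hs]
  | succ n ih =>
    have hV := rnw_V h0 hs hu0 hu (n + 1)
    have e : ∑ k ∈ Finset.range (n + 1), u k * rnwL f (n + 1 + 1 - k)
        = ∑ k ∈ Finset.range (n + 1), u k * rnwL f (n + 1 - k)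
          + ∑ k ∈ Finset.range (n + 1), u k * rnwC f (n + 1 + 1 - k) := by
      rw [← Finset.sum_add_distrib]
      refine Finset.sum_congr rfl fun k hk => ?_
      have := Finset.mem_range.1 hk
      rw [show n + 1 + 1 - k = (n + 1 - k) + 1 by omega, rnwL_succ]
      ring
    rw [Finset.sum_range_succ, show n + 1 + 1 - (n + 1) = 1 by omega] at hV ⊢
    rw [rnwC_one h0 hs] at hV
    rw [rnwL_one h0 hs, e, ih]
    push_cast
    linarith

theorem rnwA_range (hu0 : u 0 = 1) (n : ℕ) :
    ∑ k ∈ Finset.range (n + 1), u k = 1 + rnwA u n := by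
  induction n with
  | zero => simp [rnwA, hu0]
  | succ n ih =>
    rw [Finset.sum_range_succ, ih]
    unfold rnwA
    rw [Finset.sum_Icc_succ_top (by omega)]; ring

theorem rnw_lower (h0 : f 0 = 0) (hp : ∀ n, 0 ≤ f n) (hs : HasSum f 1) (hu0 : u 0 = 1)
    (hu : ∀ n, 1 ≤ n → u n = ∑ k ∈ Finset.Icc 1 n, f k * u (n - k)) (n : ℕ) :
    (n : ℝ) + 1 ≤ (1 + rnwA u n) * rnwL f (n + 1) := by
  rw [← rnw_W h0 hs hu0 hu n, ← rnwA_range hu0, Finset.sum_mul]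
  refine Finset.sum_le_sum fun k _ => ?_
  exact mul_le_mul_of_nonneg_left (rnwL_mono hp (by omega)) (rnw_u_nonneg hp hu0 hu k)

theorem rnw_final (h0 : f 0 = 0) (hp : ∀ n, 0 ≤ f n) (hs : HasSum f 1) (hu0 : u 0 = 1)
    (hu : ∀ n, 1 ≤ n → u n = ∑ k ∈ Finset.Icc 1 n, f k * u (n - k))
    {N0 : ℕ} (hN0 : 1 ≤ N0)
    (h : ∀ N, N0 ≤ N → (N : ℝ) * rnwC f N ≤ 31 / 100 * rnwL f N)
    (K : ℝ) (hK : 0 < K) (hsq : ∀ n, ∑ k ∈ Finset.Icc 1 n, (u k - u (k + 1)) ^ 2 ≤ K) :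
    (fun n : ℕ => ∑ k ∈ Finset.Icc 1 n, |u k - u (k + 1)|)
      =o[Filter.atTop] (fun n : ℕ => rnwA u n) := by
  obtain ⟨C, hC, hcube⟩ := rnwL_cube h0 hp hs hN0 h
  have hA0 : ∀ n, 0 ≤ rnwA u n := fun n =>
    Finset.sum_nonneg fun k _ => rnw_u_nonneg hp hu0 hu k
  have key : ∀ n, N0 ≤ n → ((n : ℝ) + 1) ^ 2 ≤ C * (1 + rnwA u n) ^ 3 := by
    intro n hn
    have h1 := rnw_lower h0 hp hs hu0 hu n
    have h2 := hcube (n + 1) (by omega)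
    push_cast at h2
    have hn0 : (0 : ℝ) < (n : ℝ) + 1 := by positivity
    have h3 : ((n : ℝ) + 1) ^ 3 ≤ (1 + rnwA u n) ^ 3 * (C * (n + 1)) := by
      calc _ ≤ ((1 + rnwA u n) * rnwL f (n + 1)) ^ 3 := by gcongr
        _ = (1 + rnwA u n) ^ 3 * rnwL f (n + 1) ^ 3 := by ring
        _ ≤ _ := by
          have := hA0 n
          gcongr
    have h4 : ((n : ℝ) + 1) ^ 2 * (n + 1) ≤ (C * (1 + rnwA u n) ^ 3) * (n + 1) := by
      linarith
    exact le_of_mul_le_mul_right h4 hn0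
  have hinf : Filter.Tendsto (fun n => rnwA u n) Filter.atTop Filter.atTop := by
    rw [Filter.tendsto_atTop]
    intro b
    obtain ⟨m, hm⟩ := exists_nat_gt (C * (1 + |b|) ^ 3)
    filter_upwards [Filter.eventually_ge_atTop (max N0 m)] with n hn
    by_contra hlt
    push Not at hlt
    have h1 := key n (le_trans (le_max_left _ _) hn)
    have h2 : (m : ℝ) ≤ n := by exact_mod_cast le_trans (le_max_right _ _) hn
    have h3 : C * (1 + rnwA u n) ^ 3 ≤ C * (1 + |b|) ^ 3 := by
      have := hA0 n
      have := le_abs_self b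
      gcongr
      linarith
    have : (0 : ℝ) ≤ n := by positivity
    nlinarith
  rw [Asymptotics.isLittleO_iff]
  intro ε hε
  filter_upwards [Filter.eventually_ge_atTop N0,
    hinf.eventually_ge_atTop (max 1 (8 * K ^ 2 * C / ε ^ 4))] with n hn hA
  have hA1 := le_trans (le_max_left _ _) hA
  have hA2 := le_trans (le_max_right _ _) hA
  rw [div_le_iff₀ (by positivity)] at hA2
  have hS0 : 0 ≤ ∑ k ∈ Finset.Icc 1 n, |u k - u (k + 1)| :=
    Finset.sum_nonneg fun _ _ => abs_nonneg _
  rw [Real.norm_of_nonneg hS0, Real.norm_of_nonneg (hA0 n)]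
  have hS2 : (∑ k ∈ Finset.Icc 1 n, |u k - u (k + 1)|) ^ 2 ≤ (n + 1) * K := by
    have := sq_sum_le_card_mul_sum_sq (s := Finset.Icc 1 n) (f := fun k => |u k - u (k + 1)|)
    simp only [sq_abs, Nat.card_Icc, Nat.add_sub_cancel] at this
    have h2 := hsq n
    have h3 : (0 : ℝ) ≤ n := by positivity
    nlinarith
  have hk := key n hn
  set S := ∑ k ∈ Finset.Icc 1 n, |u k - u (k + 1)|
  set A := rnwA u n
  apply le_of_pow_le_pow_left₀ (n := 4) (by norm_num) (by positivity)
  calc S ^ 4 = (S ^ 2) ^ 2 := by ring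
    _ ≤ ((n + 1) * K) ^ 2 := by gcongr
    _ = (n + 1) ^ 2 * K ^ 2 := by ring
    _ ≤ (C * (1 + A) ^ 3) * K ^ 2 := by gcongr
    _ ≤ (C * (A + A) ^ 3) * K ^ 2 := by gcongr
    _ = (8 * K ^ 2 * C) * A ^ 3 := by ring
    _ ≤ (A * ε ^ 4) * A ^ 3 := by gcongr
    _ = _ := by ring

theorem rnw_bessel (h : ℕ → ℂ) (hh : Summable fun n => ‖h n‖) (K : ℝ)
    (hK : ∀ z : ℂ, ‖z‖ = 1 → ‖∑' n, h n * z ^ n‖ ≤ K) (s : Finset ℕ) :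
    ∑ n ∈ s, ‖h n‖ ^ 2 ≤ K ^ 2 := by
  have hK0 : 0 ≤ K := (norm_nonneg _).trans (hK 1 (by simp))
  let v : ℕ → MeasureTheory.Lp ℂ 2 (@AddCircle.haarAddCircle (1 : ℝ) _) :=
    fun n => fourierLp 2 (n : ℤ)
  have hv : Orthonormal ℂ v :=
    (orthonormal_fourier (T := (1 : ℝ))).comp (fun n : ℕ => (n : ℤ)) Nat.cast_injective
  have hsm : Summable (fun n : ℕ => h n • (fourier (n : ℤ) : C(AddCircle (1 : ℝ), ℂ))) := by
    apply Summable.of_norm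
    simpa [norm_smul, fourier_norm] using hh
  obtain ⟨g, hg⟩ := hsm
  have hgx : ∀ x, ‖g x‖ ≤ K := by
    intro x
    have h1 : HasSum (fun n : ℕ => h n * ((AddCircle.toCircle x : Circle) : ℂ) ^ n) (g x) := by
      have := (ContinuousMap.evalCLM ℂ x).hasSum hg
      simpa [Function.comp_def, AddCircle.toCircle_nsmul] using this
    rw [← h1.tsum_eq]
    exact hK _ (Circle.norm_coe _)
  have hgn : ‖g‖ ≤ K := (ContinuousMap.norm_le g hK0).2 hgx
  let T := ContinuousMap.toLp (E := ℂ) 2 (@AddCircle.haarAddCircle (1 : ℝ) _) ℂ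
  have hx : HasSum (fun n => h n • v n) (T g) := by
    have := T.hasSum hg
    simpa [Function.comp_def, T, v, fourierLp] using this
  have hTg : ‖T g‖ ≤ K := by
    have h1 : ‖T‖ ≤ 1 := by
      have hm : MeasureTheory.measureUnivNNReal (@AddCircle.haarAddCircle (1 : ℝ) _) = 1 := by
        simp [MeasureTheory.measureUnivNNReal]
      refine (ContinuousMap.toLp_norm_le (p := 2) (E := ℂ) (𝕜 := ℂ)
        (μ := @AddCircle.haarAddCircle (1 : ℝ) _)).trans ?_
      simp [hm]
    calc ‖T g‖ ≤ ‖T‖ * ‖g‖ := T.le_opNorm g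
      _ ≤ 1 * K := by gcongr
      _ = K := one_mul K
  have hin : ∀ i, inner ℂ (v i) (T g) = h i := by
    intro i
    have h1 := (innerSL ℂ (v i)).hasSum hx
    have h2 : HasSum (fun n => inner ℂ (v i) (h n • v n)) (h i) := by
      have := hasSum_single (f := fun n => inner ℂ (v i) (h n • v n)) i (by
        intro b hb
        rw [inner_smul_right, hv.2 hb.symm, mul_zero])
      convert this using 1
      rw [inner_smul_right, inner_self_eq_norm_sq_to_K, hv.1 i]
      simp
    exact h1.unique h2
  have hB := hv.sum_inner_products_le (T g) (s := s)
  simp only [hin] at hB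
  exact hB.trans (by gcongr)

/-- generating function -/
noncomputable def rnwF (f : ℕ → ℝ) (z : ℂ) : ℂ := ∑' n, (f n : ℂ) * z ^ n

theorem rnw_term_le (hp : ∀ n, 0 ≤ f n) {z : ℂ} (hz : ‖z‖ ≤ 1) (n m : ℕ) :
    ‖(f n : ℂ) * z ^ m‖ ≤ f n := by
  rw [norm_mul, norm_pow, Complex.norm_real, Real.norm_of_nonneg (hp n)]
  exact mul_le_of_le_one_right (hp n) (pow_le_one₀ (norm_nonneg _) hz)

theorem rnwF_summ (hp : ∀ n, 0 ≤ f n) (hs : HasSum f 1) {z : ℂ} (hz : ‖z‖ ≤ 1) (N : ℕ) :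
    Summable (fun n => (f (N + n) : ℂ) * z ^ (N + n)) :=
  Summable.of_norm_bounded (rnw_summ hs N) fun n => rnw_term_le hp hz _ _

theorem rnwF_cont (hp : ∀ n, 0 ≤ f n) (hs : HasSum f 1) :
    ContinuousOn (rnwF f) (Metric.closedBall 0 1) := by
  apply continuousOn_tsum (u := f) (fun n => by fun_prop) hs.summable
  intro n z hz
  exact rnw_term_le hp (by simpa using hz) _ _

theorem rnwF_eq_one (h0 : f 0 = 0) (hp : ∀ n, 0 ≤ f n) (hs : HasSum f 1)
    (haper : ∀ d : ℕ, (∀ n, 1 ≤ n → 0 < f n → d ∣ n) → d = 1)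
    {z : ℂ} (hz : ‖z‖ ≤ 1) (h : rnwF f z = 1) : z = 1 := by
  have hsum : HasSum (fun n => (f n : ℂ) * z ^ n) 1 := by
    rw [← h]
    have := rnwF_summ hp hs hz 0
    simp only [zero_add] at this
    exact this.hasSum
  have hre : HasSum (fun n => f n * (z ^ n).re) 1 := by
    have := Complex.reCLM.hasSum hsum
    simpa [Function.comp_def] using this
  have hle : ∀ n, (z ^ n).re ≤ 1 := fun n =>
    (Complex.re_le_norm _).trans (by rw [norm_pow]; exact pow_le_one₀ (norm_nonneg _) hz)
  have hd := hs.sub hre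
  rw [sub_self] at hd
  have hz0 := (hasSum_zero_iff_of_nonneg (fun n => by
    exact sub_nonneg.2 (mul_le_of_le_one_right (hp n) (hle n)))).1 hd
  rw [← orderOf_eq_one_iff]
  apply haper
  intro n hn hfn
  apply orderOf_dvd_of_pow_eq_one
  have h1 := congrFun hz0 n
  simp only [Pi.zero_apply] at h1
  have h2 : (z ^ n).re = 1 := by
    have : f n * (1 - (z ^ n).re) = 0 := by linarith
    rcases mul_eq_zero.1 this with h | h <;> linarith
  have h3 : ‖z ^ n‖ ≤ 1 := by rw [norm_pow]; exact pow_le_one₀ (norm_nonneg _) hz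
  have h4 : (z ^ n).im = 0 := by
    have h5 := Complex.sq_norm (z ^ n)
    rw [Complex.normSq_apply, h2] at h5
    have h6 := norm_nonneg (z ^ n)
    have : (z ^ n).im * (z ^ n).im ≤ 0 := by nlinarith
    exact mul_self_eq_zero.1 (le_antisymm this (mul_self_nonneg _))
  apply Complex.ext <;> simp [h2, h4]

theorem rnwF_split (h0 : f 0 = 0) (hp : ∀ n, 0 ≤ f n) (hs : HasSum f 1) {z : ℂ} (hz : ‖z‖ ≤ 1)
    (N : ℕ) : 1 - rnwF f z = (1 - z) * ∑ k ∈ Finset.range N, (rnwC f (k + 1) : ℂ) * z ^ k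
      + rnwC f (N + 1) * z ^ N - ∑' n, (f (N + 1 + n) : ℂ) * z ^ (N + 1 + n) := by
  have hT : ∀ N, ∑' n, (f (N + n) : ℂ) * z ^ (N + n)
      = f N * z ^ N + ∑' n, (f (N + 1 + n) : ℂ) * z ^ (N + 1 + n) := by
    intro N
    rw [(rnwF_summ hp hs hz N).tsum_eq_zero_add]
    simp only [add_zero]
    congr 1
    apply tsum_congr
    intro k
    rw [show N + (k + 1) = N + 1 + k by ring]
  induction N with
  | zero =>
    have := hT 0
    simp only [zero_add, h0] at this
    simp [rnwF, this, rnwC_one h0 hs]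
  | succ n ih =>
    rw [ih, Finset.sum_range_succ, hT (n + 1), rnwC_succ hs (n + 1)]
    push_cast
    ring

theorem rnw_pow_sub {z : ℂ} (hz : ‖z‖ ≤ 1) (k : ℕ) : ‖1 - z ^ k‖ ≤ k * ‖1 - z‖ := by
  induction k with
  | zero => simp
  | succ n ih =>
    have : 1 - z ^ (n + 1) = (1 - z ^ n) + z ^ n * (1 - z) := by ring
    rw [this]
    refine (norm_add_le _ _).trans ?_
    have h2 : ‖z ^ n * (1 - z)‖ ≤ ‖1 - z‖ := by
      rw [norm_mul, norm_pow]
      exact mul_le_of_le_one_left (norm_nonneg _) (pow_le_one₀ (norm_nonneg _) hz)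
    push_cast
    linarith

theorem rnwF_lower (h0 : f 0 = 0) (hp : ∀ n, 0 ≤ f n) (hs : HasSum f 1) {z : ℂ} (hz : ‖z‖ ≤ 1)
    (N : ℕ) : ‖1 - z‖ * (rnwL f N - ‖1 - z‖ * ∑ k ∈ Finset.range N, (k : ℝ) * rnwC f (k + 1))
      - 2 * rnwC f (N + 1) ≤ ‖1 - rnwF f z‖ := by
  set P := ∑ k ∈ Finset.range N, (rnwC f (k + 1) : ℂ) * z ^ k with hP
  set R := ∑' n, (f (N + 1 + n) : ℂ) * z ^ (N + 1 + n) with hR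
  have hRb : ‖R‖ ≤ rnwC f (N + 1) :=
    tsum_of_norm_bounded (rnw_summ hs (N + 1)).hasSum fun n => rnw_term_le hp hz _ _
  have hcb : ‖(rnwC f (N + 1) : ℂ) * z ^ N‖ ≤ rnwC f (N + 1) :=
    rnw_term_le (f := rnwC f) (rnwC_nonneg hp) hz _ _
  have hPb : rnwL f N - ‖1 - z‖ * ∑ k ∈ Finset.range N, (k : ℝ) * rnwC f (k + 1) ≤ ‖P‖ := by
    have e : (rnwL f N : ℂ) = P + ∑ k ∈ Finset.range N, (rnwC f (k + 1) : ℂ) * (1 - z ^ k) := by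
      rw [hP, ← Finset.sum_add_distrib, rnwL_range]
      push_cast
      exact Finset.sum_congr rfl fun k _ => by ring
    have hL0 : 0 ≤ rnwL f N := Finset.sum_nonneg fun _ _ => rnwC_nonneg hp _
    have h1 : rnwL f N = ‖(rnwL f N : ℂ)‖ := by
      rw [Complex.norm_real, Real.norm_of_nonneg hL0]
    have h2 : ‖∑ k ∈ Finset.range N, (rnwC f (k + 1) : ℂ) * (1 - z ^ k)‖
        ≤ ‖1 - z‖ * ∑ k ∈ Finset.range N, (k : ℝ) * rnwC f (k + 1) := by
      rw [Finset.mul_sum]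
      refine norm_sum_le_of_le _ fun k _ => ?_
      rw [norm_mul, Complex.norm_real, Real.norm_of_nonneg (rnwC_nonneg hp _)]
      have := mul_le_mul_of_nonneg_left (rnw_pow_sub hz k) (rnwC_nonneg hp (k + 1))
      linarith
    have h3 := norm_add_le P (∑ k ∈ Finset.range N, (rnwC f (k + 1) : ℂ) * (1 - z ^ k))
    rw [← e, ← h1] at h3
    linarith
  rw [rnwF_split h0 hp hs hz N]
  have h4 : ‖(1 - z) * P‖ ≤ ‖(1 - z) * P + rnwC f (N + 1) * z ^ N - R‖
      + ‖(rnwC f (N + 1) : ℂ) * z ^ N‖ + ‖R‖ := by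
    have e : (1 - z) * P = ((1 - z) * P + rnwC f (N + 1) * z ^ N - R)
      - rnwC f (N + 1) * z ^ N + R := by ring
    calc ‖(1 - z) * P‖ = ‖((1 - z) * P + rnwC f (N + 1) * z ^ N - R)
      - rnwC f (N + 1) * z ^ N + R‖ := by rw [← e]
      _ ≤ _ := (norm_add_le _ _).trans (by gcongr; exact norm_sub_le _ _)
  rw [norm_mul] at h4
  have := mul_le_mul_of_nonneg_left hPb (norm_nonneg (1 - z))
  linarith

theorem rnw_near (h0 : f 0 = 0) (hp : ∀ n, 0 ≤ f n) (hs : HasSum f 1)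
    {N0 : ℕ} (hN0 : 1 ≤ N0)
    (h : ∀ N, N0 ≤ N → (N : ℝ) * rnwC f N ≤ 31 / 100 * rnwL f N) :
    ∃ δ : ℝ, 0 < δ ∧ ∀ z : ℂ, ‖z‖ ≤ 1 → ‖1 - z‖ < δ → ‖1 - z‖ * (5 / 100) ≤ ‖1 - rnwF f z‖ := by
  obtain ⟨B, hB0, hB⟩ : ∃ B : ℝ, 0 ≤ B ∧ ∀ N, N0 ≤ N →
      ∑ k ∈ Finset.range N, (k : ℝ) * rnwC f (k + 1) ≤ 31 / 100 * N * rnwL f N + B := by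
    refine ⟨∑ k ∈ Finset.range N0, (k : ℝ) * rnwC f (k + 1),
      Finset.sum_nonneg fun k _ => mul_nonneg (by positivity) (rnwC_nonneg hp _), fun N hN => ?_⟩
    induction N, hN using Nat.le_induction with
    | base =>
      have : 0 ≤ rnwL f N0 := Finset.sum_nonneg fun _ _ => rnwC_nonneg hp _
      have : 0 ≤ 31 / 100 * (N0 : ℝ) * rnwL f N0 := by positivity
      linarith
    | succ n hn ih =>
      rw [Finset.sum_range_succ]
      have h1 := h (n + 1) (by omega)
      have h2 := rnwC_nonneg hp (n + 1)
      have h3 := rnwL_succ (f := f) n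
      have h4 : (0 : ℝ) ≤ n := by positivity
      push_cast at h1 ⊢
      have h5 : 0 ≤ (n : ℝ) * rnwC f (n + 1) := by positivity
      nlinarith
  refine ⟨min (1 / (N0 : ℝ)) (2 / 100 / (B + 1)), ?_, fun z hz hw => ?_⟩
  · have : (0 : ℝ) < N0 := by exact_mod_cast hN0
    positivity
  have hN0' : (1 : ℝ) ≤ N0 := by exact_mod_cast hN0
  have hw1 := hw.trans_le (min_le_left _ _)
  have hw2 := hw.trans_le (min_le_right _ _)
  rcases (norm_nonneg (1 - z)).eq_or_lt with h' | hwpos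
  · rw [← h']; simp
  rw [lt_div_iff₀ (by linarith)] at hw1
  rw [lt_div_iff₀ (by linarith)] at hw2
  have key := fun N => rnwF_lower h0 hp hs hz N
  set w := ‖1 - z‖ with hwdef
  set N := ⌈1 / w⌉₊ with hN
  have hNl : 1 ≤ N * w := by
    have := Nat.le_ceil (1 / w)
    rw [div_le_iff₀ hwpos] at this
    exact this
  have hNu : N * w ≤ 2 := by
    have h1 := Nat.ceil_lt_add_one (a := 1 / w) (by positivity)
    have h2 : (1 / w + 1) * w = 1 + w := by field_simp
    have h3 : w ≤ 1 := by nlinarith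
    have h4 : (N : ℝ) * w ≤ (1 / w + 1) * w := mul_le_mul_of_nonneg_right h1.le hwpos.le
    linarith
  have hNN0 : N0 ≤ N := by
    have h1 : (N0 : ℝ) * w < N * w := by linarith
    have := lt_of_mul_lt_mul_right h1 hwpos.le
    exact_mod_cast this.le
  have k1 := key N
  have k2 := hB N hNN0
  have k3 := h N hNN0
  have k4 := rnwC_le hp hs N
  have k5 := rnwL_ge h0 hp hs N (hN0.trans hNN0)
  set L := rnwL f N
  set D := ∑ k ∈ Finset.range N, (k : ℝ) * rnwC f (k + 1)
  set n : ℝ := (N : ℝ)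
  have hn : 0 < n := by
    by_contra hcon
    push Not at hcon
    nlinarith
  -- 2 c ≤ w * (31/50) L / x  with x = n w; and x + 2/x ≤ 3
  have e1 : 2 / (n * w) ≤ 3 - n * w := by
    rw [div_le_iff₀ (by positivity)]
    nlinarith
  have e2 : 2 * rnwC f N ≤ w * (31 / 100 * L * (2 / (n * w))) := by
    have e3 : w * (31 / 100 * L * (2 / (n * w))) = 2 * (31 / 100 * L) / n := by field_simp
    rw [e3, le_div_iff₀ hn]
    linarith
  have e4 : w * (31 / 100 * L * (2 / (n * w))) ≤ w * (31 / 100 * L * (3 - n * w)) := by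
    gcongr
  have e5 : w * D ≤ w * (31 / 100 * n * L + B) := by gcongr
  have e6 : w * (L - w * (31 / 100 * n * L + B)) ≤ w * (L - w * D) := by gcongr
  have e7 : w * (5 / 100) ≤ w * (L - w * (31 / 100 * n * L + B) - 31 / 100 * L * (3 - n * w)) := by
    gcongr
    nlinarith
  linarith

theorem rnw_bound (h0 : f 0 = 0) (hp : ∀ n, 0 ≤ f n) (hs : HasSum f 1)
    (haper : ∀ d : ℕ, (∀ n, 1 ≤ n → 0 < f n → d ∣ n) → d = 1)
    {N0 : ℕ} (hN0 : 1 ≤ N0)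
    (h : ∀ N, N0 ≤ N → (N : ℝ) * rnwC f N ≤ 31 / 100 * rnwL f N) :
    ∃ K : ℝ, 0 < K ∧ ∀ z : ℂ, ‖z‖ ≤ 1 → ‖1 - z‖ ≤ K * ‖1 - rnwF f z‖ := by
  obtain ⟨δ, hδ, hn⟩ := rnw_near h0 hp hs hN0 h
  let S : Set ℂ := Metric.closedBall 0 1 ∩ {z | δ ≤ ‖1 - z‖}
  have hSc : IsCompact S := (isCompact_closedBall _ _).inter_right
    (isClosed_le continuous_const (by fun_prop))
  have hcont : ContinuousOn (fun z => ‖1 - rnwF f z‖) S :=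
    ((continuousOn_const.sub (rnwF_cont hp hs)).norm).mono Set.inter_subset_left
  have hfar : ∃ m : ℝ, 0 < m ∧ ∀ z ∈ S, m ≤ ‖1 - rnwF f z‖ := by
    rcases S.eq_empty_or_nonempty with he | hne
    · exact ⟨1, one_pos, by simp [he]⟩
    · obtain ⟨z0, hz0, hmin⟩ := hSc.exists_isMinOn hne hcont
      refine ⟨‖1 - rnwF f z0‖, ?_, fun z hz => hmin hz⟩
      rw [norm_pos_iff]
      intro hzero
      have h1 : z0 = 1 := rnwF_eq_one h0 hp hs haper (by simpa using hz0.1)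
        (sub_eq_zero.1 hzero).symm
      have h2 : δ ≤ ‖1 - z0‖ := hz0.2
      rw [h1] at h2
      simp at h2
      linarith
  obtain ⟨m, hm, hmS⟩ := hfar
  refine ⟨20 + 2 / m, by positivity, fun z hz => ?_⟩
  have hF := norm_nonneg (1 - rnwF f z)
  rw [add_mul]
  have hpos2 : 0 ≤ 2 / m * ‖1 - rnwF f z‖ := by positivity
  by_cases hd : ‖1 - z‖ < δ
  · have := hn z hz hd
    linarith
  · push Not at hd
    have h1 := hmS z ⟨by simpa using hz, hd⟩
    have h2 : 2 ≤ 2 / m * ‖1 - rnwF f z‖ := by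
      rw [div_mul_eq_mul_div, le_div_iff₀ hm]; linarith
    have h3 : ‖1 - z‖ ≤ 2 := by
      have := norm_sub_le (1 : ℂ) z
      simp at this
      linarith
    linarith

theorem rnwU_summ (hup : ∀ n, 0 ≤ u n) (hu1 : ∀ n, u n ≤ 1) {z : ℂ} (hz : ‖z‖ < 1) :
    Summable fun n => ‖(u n : ℂ) * z ^ n‖ := by
  refine Summable.of_nonneg_of_le (fun _ => norm_nonneg _) (fun n => ?_)
    (summable_geometric_of_lt_one (norm_nonneg z) hz)
  rw [norm_mul, norm_pow, Complex.norm_real, Real.norm_of_nonneg (hup n)]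
  exact mul_le_of_le_one_left (by positivity) (hu1 n)

theorem rnwU_mul (h0 : f 0 = 0) (hp : ∀ n, 0 ≤ f n) (hs : HasSum f 1) (hu0 : u 0 = 1)
    (hu : ∀ n, 1 ≤ n → u n = ∑ k ∈ Finset.Icc 1 n, f k * u (n - k)) {z : ℂ} (hz : ‖z‖ < 1) :
    (∑' n, (u n : ℂ) * z ^ n) * (1 - rnwF f z) = 1 := by
  have hup := rnw_u_nonneg hp hu0 hu
  have hS := rnwU_summ hup (rnw_u_le hp hs hu0 hu) hz
  have hF : Summable fun n => ‖(f n : ℂ) * z ^ n‖ :=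
    Summable.of_nonneg_of_le (fun _ => norm_nonneg _)
      (fun n => rnw_term_le hp hz.le n n) hs.summable
  have hprod := tsum_mul_tsum_eq_tsum_sum_range_of_summable_norm hS hF
  have hc : ∀ n, ∑ k ∈ Finset.range (n + 1), ((u k : ℂ) * z ^ k) * ((f (n - k) : ℂ) * z ^ (n - k))
      = (∑ k ∈ Finset.range (n + 1), u k * f (n - k) : ℝ) * z ^ n := by
    intro n
    push_cast
    rw [Finset.sum_mul]
    refine Finset.sum_congr rfl fun k hk => ?_
    have := Finset.mem_range.1 hk
    have e : z ^ n = z ^ k * z ^ (n - k) := by rw [← pow_add]; congr 1; omega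
    rw [e]; ring
  simp only [hc] at hprod
  have hU := hS.of_norm.tsum_eq_zero_add
  have hc2 : ∀ n, (∑ k ∈ Finset.range (n + 1 + 1), u k * f (n + 1 - k) : ℝ) = u (n + 1) := by
    intro n
    rw [Finset.sum_range_succ, Nat.sub_self, h0, mul_zero, add_zero, rnw_u_range hu]
  have hP := (summable_norm_sum_mul_range_of_summable_norm hS hF).of_norm
  simp only [hc] at hP
  rw [hP.tsum_eq_zero_add] at hprod
  simp only [hc2] at hprod
  simp [h0] at hprod
  simp [hu0] at hU
  rw [mul_sub, mul_one]
  unfold rnwF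
  rw [hprod, hU]
  ring

theorem rnw_sq (h0 : f 0 = 0) (hp : ∀ n, 0 ≤ f n) (hs : HasSum f 1) (hu0 : u 0 = 1)
    (hu : ∀ n, 1 ≤ n → u n = ∑ k ∈ Finset.Icc 1 n, f k * u (n - k))
    {K : ℝ} (hK0 : 0 < K) (hK : ∀ z : ℂ, ‖z‖ ≤ 1 → ‖1 - z‖ ≤ K * ‖1 - rnwF f z‖) (s : Finset ℕ) :
    ∑ k ∈ s, (u k - u (k + 1)) ^ 2 ≤ (2 * (1 + K)) ^ 2 := by
  have hup := rnw_u_nonneg hp hu0 hu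
  have hu1 := rnw_u_le hp hs hu0 hu
  have main : ∀ z : ℂ, 1 / 2 < ‖z‖ → ‖z‖ < 1 →
      ‖∑' n, ((u n - u (n + 1) : ℝ) : ℂ) * z ^ n‖ ≤ 2 * (1 + K) := by
    intro z hz2 hz1
    have hS := (rnwU_summ hup hu1 hz1).of_norm
    have hS' := (rnwU_summ (u := fun n => u (n + 1)) (fun n => hup _) (fun n => hu1 _) hz1).of_norm
    have hU := hS.tsum_eq_zero_add
    have hm := rnwU_mul h0 hp hs hu0 hu hz1
    have e1 : ∑' n, ((u n - u (n + 1) : ℝ) : ℂ) * z ^ n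
        = (∑' n, (u n : ℂ) * z ^ n) - ∑' n, (u (n + 1) : ℂ) * z ^ n := by
      rw [← hS.tsum_sub hS']
      apply tsum_congr
      intro n
      push_cast
      ring
    have e2 : ∑' n, (u (n + 1) : ℂ) * z ^ (n + 1) = z * ∑' n, (u (n + 1) : ℂ) * z ^ n := by
      rw [← tsum_mul_left]
      apply tsum_congr
      intro n
      ring
    rw [e2] at hU
    simp only [hu0, pow_zero, mul_one, Complex.ofReal_one] at hU
    rw [e1]
    set U := ∑' n, (u n : ℂ) * z ^ n
    set V := ∑' n, (u (n + 1) : ℂ) * z ^ n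
    have e3 : z * (U - V) = 1 - (1 - z) * U := by linear_combination hU
    have e4 : ‖(1 - z) * U‖ ≤ K := by
      have h1 := congrArg norm hm
      rw [norm_mul, norm_one] at h1
      rw [norm_mul]
      calc ‖1 - z‖ * ‖U‖ ≤ (K * ‖1 - rnwF f z‖) * ‖U‖ := by
            gcongr
            exact hK z hz1.le
        _ = K * (‖U‖ * ‖1 - rnwF f z‖) := by ring
        _ = K := by rw [h1, mul_one]
    have e5 : ‖z‖ * ‖U - V‖ ≤ 1 + K := by
      rw [← norm_mul, e3]
      refine (norm_sub_le _ _).trans ?_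
      rw [norm_one]; linarith
    nlinarith [norm_nonneg (U - V)]
  have hr : ∀ r : ℝ, 1 / 2 < r → r < 1 →
      ∑ k ∈ s, (u k - u (k + 1)) ^ 2 * (r ^ k) ^ 2 ≤ (2 * (1 + K)) ^ 2 := by
    intro r hr2 hr1
    have hr0 : 0 < r := by linarith
    have hrn : ‖(r : ℂ)‖ = r := by rw [Complex.norm_real, Real.norm_of_nonneg hr0.le]
    have hb := rnw_bessel (fun n => ((u n - u (n + 1) : ℝ) : ℂ) * (r : ℂ) ^ n) ?_ (2 * (1 + K)) ?_ s
    · refine le_of_eq_of_le (Finset.sum_congr rfl fun k _ => ?_) hb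
      rw [norm_mul, norm_pow, hrn, Complex.norm_real, mul_pow, Real.norm_eq_abs, sq_abs]
    · refine Summable.of_nonneg_of_le (fun _ => norm_nonneg _) (fun n => ?_)
        (summable_geometric_of_lt_one hr0.le hr1)
      rw [norm_mul, norm_pow, hrn, Complex.norm_real, Real.norm_eq_abs]
      refine mul_le_of_le_one_left (by positivity) (abs_le.2 ⟨?_, ?_⟩) <;>
        linarith [hup n, hu1 n, hup (n + 1), hu1 (n + 1)]
    · intro z hz
      have := main (r * z) (by rw [norm_mul, hrn, hz]; linarith)
        (by rw [norm_mul, hrn, hz]; linarith)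
      simpa only [mul_pow, mul_assoc] using this
  have hlim : Filter.Tendsto (fun r : ℝ => ∑ k ∈ s, (u k - u (k + 1)) ^ 2 * (r ^ k) ^ 2)
      (nhdsWithin 1 (Set.Iio 1)) (nhds (∑ k ∈ s, (u k - u (k + 1)) ^ 2 * ((1 : ℝ) ^ k) ^ 2)) := by
    apply Filter.Tendsto.mono_left _ nhdsWithin_le_nhds
    apply Continuous.tendsto (f := fun r : ℝ => ∑ k ∈ s, (u k - u (k + 1)) ^ 2 * (r ^ k) ^ 2)
    fun_prop
  simp only [one_pow, mul_one] at hlim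
  refine le_of_tendsto hlim ?_
  have : Set.Ioo (1 / 2 : ℝ) 1 ∈ nhdsWithin (1 : ℝ) (Set.Iio 1) :=
    Ioo_mem_nhdsLT (by norm_num)
  filter_upwards [this] with r hr'
  exact hr r hr'.1 hr'.2

end rnwaux

/-- If `u` is an aperiodic recurrent renewal sequence with lifetime
distribution `f` and `limsup_N N·c(N)/L(N) < 1/(√5+1)`, then `u` is smooth:
`∑_{k=1}^{n} |u k − u (k+1)| = o(a n)`. -/
theorem stmt0 (f u : ℕ → ℝ)
    (hf0 : f 0 = 0) (hfpos : ∀ n, 0 ≤ f n) (hfsum : HasSum f 1)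
    (hu0 : u 0 = 1)
    (hu : ∀ n, 1 ≤ n → u n = ∑ k ∈ Finset.Icc 1 n, f k * u (n - k))
    (haper : ∀ d : ℕ, (∀ n, 1 ≤ n → 0 < f n → d ∣ n) → d = 1)
    (hlim : Filter.limsup (fun N : ℕ => (N : ℝ) * rnwC f N / rnwL f N) Filter.atTop
      < 1 / (Real.sqrt 5 + 1)) :
    (fun n : ℕ => ∑ k ∈ Finset.Icc 1 n, |u k - u (k + 1)|)
      =o[Filter.atTop] (fun n : ℕ => rnwA u n) := by
  obtain ⟨N0, hN0, h⟩ := rnw_ev hf0 hfpos hfsum hlim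
  obtain ⟨K, hK0, hK⟩ := rnw_bound hf0 hfpos hfsum haper hN0 h
  exact rnw_final hf0 hfpos hfsum hu0 hu hN0 h ((2 * (1 + K)) ^ 2) (by positivity)
    fun n => rnw_sq hf0 hfpos hfsum hu0 hu hK0 hK _
end

section
/- Let u be an aperiodic recurrent renewal sequence with lifetime distribution f. If limsup_{N→∞} N·c(N)/L(N) < 1/(√5+1), then ∑_{k=1}^{∞} (u(k) − u(k+1))² < ∞. -/
open Filter Finset

lemma aux_c_succ (f : ℕ → ℝ) (hs : Summable f) (N : ℕ) : rnwC f N = f N + rnwC f (N + 1) := by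
  unfold rnwC
  have h : Summable (fun k => f (N + k)) := by
    simpa [add_comm] using (summable_nat_add_iff N).2 hs
  rw [h.tsum_eq_zero_add]
  simp [add_assoc, add_comm 1]

lemma aux_c_nonneg (f : ℕ → ℝ) (hf : ∀ n, 0 ≤ f n) (N : ℕ) : 0 ≤ rnwC f N :=
  tsum_nonneg fun _ => hf _

lemma aux_L (f : ℕ → ℝ) (N : ℕ) : rnwL f (N + 1) = rnwL f N + rnwC f (N + 1) := by
  unfold rnwL
  rw [Finset.sum_Icc_succ_top (by omega)]

lemma aux_L' (f : ℕ → ℝ) (N : ℕ) : rnwL f N = ∑ k ∈ range N, rnwC f (k + 1) := by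
  induction N with
  | zero => simp [rnwL]
  | succ n ih => rw [aux_L, ih, sum_range_succ]

lemma aux_summ (f : ℕ → ℝ) (hf : ∀ n, 0 ≤ f n) (hs : Summable f) (z : ℂ) (hz : ‖z‖ ≤ 1) :
    Summable (fun n => (f n : ℂ) * z ^ n) := by
  refine Summable.of_norm_bounded hs fun n => ?_
  rw [norm_mul, norm_pow, Complex.norm_real, Real.norm_of_nonneg (hf n)]
  exact mul_le_of_le_one_right (hf n) (pow_le_one₀ (norm_nonneg _) hz)

lemma aux_summD (f : ℕ → ℝ) (hf : ∀ n, 0 ≤ f n) (hs : Summable f) (z : ℂ) (hz : ‖z‖ ≤ 1)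
    (N : ℕ) : Summable (fun j => (f (N + 1 + j) : ℂ) * (1 - z ^ (j + 1))) := by
  have h : Summable (fun k => 2 * f (N + 1 + k)) := by
    simpa [add_comm] using ((summable_nat_add_iff (N+1)).2 hs).mul_left 2
  refine Summable.of_norm_bounded h fun n => ?_
  rw [norm_mul, Complex.norm_real, Real.norm_of_nonneg (hf _), mul_comm]
  refine mul_le_mul_of_nonneg_right ?_ (hf _)
  calc ‖1 - z ^ (n+1)‖ ≤ ‖(1:ℂ)‖ + ‖z ^ (n+1)‖ := norm_sub_le _ _
    _ ≤ 1 + 1 := by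
      rw [norm_pow, norm_one]
      gcongr
      exact pow_le_one₀ (norm_nonneg _) hz
    _ = 2 := by norm_num

noncomputable def auxD (f : ℕ → ℝ) (z : ℂ) (N : ℕ) : ℂ :=
  ∑' j : ℕ, (f (N + 1 + j) : ℂ) * (1 - z ^ (j + 1))

lemma auxD_norm (f : ℕ → ℝ) (hf : ∀ n, 0 ≤ f n) (hs : Summable f) (z : ℂ) (hz : ‖z‖ ≤ 1)
    (N : ℕ) : ‖auxD f z N‖ ≤ 2 * rnwC f (N + 1) := by
  have h : Summable (fun k => f (N + 1 + k)) := by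
    simpa [add_comm] using ((summable_nat_add_iff (N+1)).2 hs)
  unfold auxD rnwC
  rw [← tsum_mul_left]
  refine tsum_of_norm_bounded (h.mul_left 2).hasSum fun n => ?_
  rw [norm_mul, Complex.norm_real, Real.norm_of_nonneg (hf _), mul_comm]
  refine mul_le_mul_of_nonneg_right ?_ (hf _)
  calc ‖1 - z ^ (n+1)‖ ≤ ‖(1:ℂ)‖ + ‖z ^ (n+1)‖ := norm_sub_le _ _
    _ ≤ 1 + 1 := by
      rw [norm_pow, norm_one]
      gcongr
      exact pow_le_one₀ (norm_nonneg _) hz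
    _ = 2 := by norm_num

lemma auxD_succ (f : ℕ → ℝ) (hf : ∀ n, 0 ≤ f n) (hs : Summable f) (z : ℂ) (hz : ‖z‖ ≤ 1)
    (N : ℕ) : auxD f z N = (1 - z) * (rnwC f (N + 1) : ℂ) + z * auxD f z (N + 1) := by
  have h : Summable (fun k => f (N + 1 + k)) := by
    simpa [add_comm] using ((summable_nat_add_iff (N+1)).2 hs)
  have h' : Summable (fun k => (f (N + 1 + k) : ℂ)) := by exact_mod_cast h
  have h2 := aux_summD f hf hs z hz (N+1)
  have hD := aux_summD f hf hs z hz N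
  have e : ∀ j : ℕ, (f (N + 1 + j) : ℂ) * (1 - z ^ (j + 1)) - (1 - z) * (f (N+1+j) : ℂ)
      = (f (N+1+j) : ℂ) * (z * (1 - z ^ j)) := fun j => by ring
  have e2 : auxD f z N - (1 - z) * (rnwC f (N+1) : ℂ)
      = ∑' j : ℕ, (f (N+1+j) : ℂ) * (z * (1 - z ^ j)) := by
    unfold auxD rnwC
    rw [Complex.ofReal_tsum, ← tsum_mul_left, ← hD.tsum_sub (h'.mul_left _)]
    exact tsum_congr e
  have hS : Summable (fun j : ℕ => (f (N+1+j) : ℂ) * (z * (1 - z ^ j))) :=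
    (hD.sub (h'.mul_left (1 - z))).congr e
  rw [hS.tsum_eq_zero_add] at e2
  rw [← sub_eq_iff_eq_add', e2]
  unfold auxD
  rw [← tsum_mul_left]
  simp only [pow_zero, sub_self, mul_zero, zero_add]
  refine tsum_congr fun j => ?_
  rw [show N + 1 + (j + 1) = N + 1 + 1 + j by ring]
  ring

lemma aux_expand (f : ℕ → ℝ) (hf : ∀ n, 0 ≤ f n) (hf0 : f 0 = 0) (hs : HasSum f 1) (z : ℂ)
    (hz : ‖z‖ ≤ 1) (N : ℕ) : 1 - ∑' n, (f n : ℂ) * z ^ n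
      = (1 - z) * ∑ k ∈ range N, (rnwC f (k + 1) : ℂ) * z ^ k + z ^ N * auxD f z N := by
  induction N with
  | zero =>
    have h1 : ∑' n, (f n : ℂ) = 1 := by
      rw [← Complex.ofReal_tsum, hs.tsum_eq]; simp
    have hsc : Summable (fun n => (f n : ℂ)) := by exact_mod_cast hs.summable
    have hz' := aux_summ f hf hs.summable z hz
    rw [← h1, ← hsc.tsum_sub hz', (hsc.sub hz').tsum_eq_zero_add]
    simp only [hf0, auxD, range_zero, sum_empty, mul_zero, pow_zero]
    simp only [Complex.ofReal_zero, zero_mul, sub_self, zero_add, one_mul]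
    refine tsum_congr fun j => ?_
    rw [add_comm 1 j]; ring
  | succ n ih =>
    rw [ih, auxD_succ f hf hs.summable z hz n, sum_range_succ]
    ring

lemma aux_pow (z : ℂ) (hz : ‖z‖ ≤ 1) (k : ℕ) : ‖1 - z ^ k‖ ≤ k * ‖1 - z‖ := by
  induction k with
  | zero => simp
  | succ k ih =>
    have : 1 - z ^ (k+1) = (1 - z ^ k) + z ^ k * (1 - z) := by ring
    rw [this]
    refine (norm_add_le _ _).trans ?_
    rw [norm_mul, norm_pow]
    have := mul_le_of_le_one_left (norm_nonneg (1 - z)) (pow_le_one₀ (n := k) (norm_nonneg z) hz)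
    push_cast
    linarith

lemma aux_lower (f : ℕ → ℝ) (hf : ∀ n, 0 ≤ f n) (hf0 : f 0 = 0) (hs : HasSum f 1) (z : ℂ)
    (hz : ‖z‖ ≤ 1) (N : ℕ) :
    ‖1 - z‖ * (rnwL f N - ‖1 - z‖ * ∑ k ∈ range N, k * rnwC f (k + 1)) - 2 * rnwC f (N + 1)
      ≤ ‖1 - ∑' n, (f n : ℂ) * z ^ n‖ := by
  rw [aux_expand f hf hf0 hs z hz N]
  have h1 : ‖z ^ N * auxD f z N‖ ≤ 2 * rnwC f (N + 1) := by
    rw [norm_mul, norm_pow]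
    exact (mul_le_of_le_one_left (norm_nonneg _) (pow_le_one₀ (norm_nonneg _) hz)).trans
      (auxD_norm f hf hs.summable z hz N)
  have h2 : ‖(rnwL f N : ℂ) - ∑ k ∈ range N, (rnwC f (k + 1) : ℂ) * z ^ k‖
      ≤ ‖1 - z‖ * ∑ k ∈ range N, k * rnwC f (k + 1) := by
    rw [aux_L', Complex.ofReal_sum, ← sum_sub_distrib, mul_sum]
    refine norm_sum_le_of_le _ fun k _ => ?_
    have : (rnwC f (k + 1) : ℂ) - (rnwC f (k + 1) : ℂ) * z ^ k
      = (rnwC f (k + 1) : ℂ) * (1 - z ^ k) := by ring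
    rw [this, norm_mul, Complex.norm_real, Real.norm_of_nonneg (aux_c_nonneg f hf _)]
    have := mul_le_mul_of_nonneg_left (aux_pow z hz k) (aux_c_nonneg f hf (k+1))
    linarith
  have h3 : rnwL f N ≤ ‖(rnwL f N : ℂ)‖ := by
    rw [Complex.norm_real]; exact le_abs_self _
  have h4 := norm_sub_norm_le (rnwL f N : ℂ) (∑ k ∈ range N, (rnwC f (k + 1) : ℂ) * z ^ k)
  have h5 : ‖1 - z‖ * (rnwL f N - ‖1 - z‖ * ∑ k ∈ range N, k * rnwC f (k + 1))
      ≤ ‖(1 - z) * ∑ k ∈ range N, (rnwC f (k + 1) : ℂ) * z ^ k‖ := by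
    rw [norm_mul]
    exact mul_le_mul_of_nonneg_left (by linarith) (norm_nonneg _)
  have h6 := norm_sub_le_norm_add ((1 - z) * ∑ k ∈ range N, (rnwC f (k + 1) : ℂ) * z ^ k)
    (z ^ N * auxD f z N)
  linarith

lemma aux_near (f : ℕ → ℝ) (hf : ∀ n, 0 ≤ f n) (hf0 : f 0 = 0) (hs : HasSum f 1)
    (a : ℝ) (ha0 : 0 < a) (ha : a < 1 / 3)
    (hev : ∀ᶠ N : ℕ in atTop, (N : ℝ) * rnwC f N ≤ a * rnwL f N) :
    ∃ ε > 0, ∃ δ > 0, ∀ z : ℂ, ‖z‖ ≤ 1 → ‖1 - z‖ < ε →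
      δ * ‖1 - z‖ ≤ ‖1 - ∑' n, (f n : ℂ) * z ^ n‖ := by
  have hc0 : Tendsto (rnwC f) atTop (nhds 0) := by
    have := tendsto_sum_nat_add f
    refine this.congr fun N => ?_
    simp [rnwC, add_comm]
  have hη : (0:ℝ) < (1 - 3 * a) / 4 := by linarith
  have hev2 := hc0.eventually (gt_mem_nhds hη)
  obtain ⟨N0, hN0⟩ := eventually_atTop.1 (hev.and hev2)
  have hcn := aux_c_nonneg f hf
  have hc1 : rnwC f 1 = 1 := by
    have h0 : rnwC f 0 = 1 := by simp [rnwC, hs.tsum_eq]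
    have := aux_c_succ f hs.summable 0
    rw [h0, hf0] at this
    simpa using this.symm
  have hL0 : ∀ N, 0 ≤ rnwL f N := fun N => by
    rw [aux_L']; exact sum_nonneg fun _ _ => hcn _
  have hL1 : ∀ N, 1 ≤ rnwL f (N + 1) := fun N => by
    rw [aux_L', ← hc1]
    exact single_le_sum (f := fun k => rnwC f (k+1)) (fun _ _ => hcn _) (mem_range.2 (Nat.succ_pos N))
  set Q : ℕ → ℝ := fun N => ∑ k ∈ range N, k * rnwC f (k + 1) with hQ
  have hQ0 : 0 ≤ Q N0 := sum_nonneg fun k _ => mul_nonneg (Nat.cast_nonneg _) (hcn _)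
  have hQb : ∀ N, N0 ≤ N → Q N ≤ Q N0 + a * N * rnwL f N := by
    intro N hN
    induction N, hN using Nat.le_induction with
    | base =>
      have := hL0 N0
      have : 0 ≤ a * N0 * rnwL f N0 := by positivity
      linarith
    | succ n hn ih =>
      have e : Q (n+1) = Q n + n * rnwC f (n+1) := by simp [hQ, sum_range_succ]
      have h1 := (hN0 (n+1) (by omega)).1
      have h2 := hcn (n+1)
      have h3 := aux_L f n
      have h4 : 0 ≤ a * n * rnwC f (n+1) := by positivity
      push_cast at h1 ⊢
      rw [e]
      rw [h3] at h1 ⊢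
      nlinarith
  refine ⟨min (1 / (N0 + 1)) ((1 - 3 * a) / 4 / (Q N0 + 1)), by positivity, (1 - 3 * a) / 2,
    by linarith, fun z hz hzε => ?_⟩
  obtain ⟨hz1, hz2⟩ := lt_min_iff.1 hzε
  rcases eq_or_lt_of_le (norm_nonneg (1 - z)) with h0 | hpos
  · rw [← h0]; simp
  set s := ‖1 - z‖ with hs'
  set N := ⌊1 / s⌋₊ with hN
  have hsN : s * N ≤ 1 := by
    have := Nat.floor_le (a := 1 / s) (by positivity)
    rw [le_div_iff₀ hpos] at this
    linarith
  have hsN1 : 1 < s * (N + 1) := by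
    have := Nat.lt_floor_add_one (1 / s)
    rw [div_lt_iff₀ hpos] at this
    linarith
  have hNN : N0 + 1 ≤ N := by
    refine Nat.le_floor ?_
    rw [le_div_iff₀ hpos]
    rw [lt_div_iff₀ (by positivity)] at hz1
    push_cast
    linarith
  have hlow := aux_lower f hf hf0 hs z hz N
  rw [← hs'] at hlow
  refine le_trans ?_ hlow
  have hQN := hQb N (by omega)
  have hc := hN0 (N+1) (by omega)
  have hLN : 1 ≤ rnwL f N := by
    obtain ⟨m, hm⟩ : ∃ m, N = m + 1 := ⟨N - 1, by omega⟩
    rw [hm]; exact hL1 m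
  have hsK : s * Q N0 ≤ (1 - 3 * a) / 4 := by
    rw [lt_div_iff₀ (by positivity)] at hz2
    linarith
  have h1 : s * Q N ≤ (1 - 3 * a) / 4 + a * rnwL f N := by
    have h := mul_le_mul_of_nonneg_left hQN hpos.le
    have h' := mul_le_mul_of_nonneg_right hsN (show 0 ≤ a * rnwL f N by positivity)
    linarith
  have h2 : 2 * rnwC f (N+1) ≤ s * (2 * a * rnwL f N + (1 - 3 * a) / 4) := by
    have g1 := mul_le_mul_of_nonneg_right hsN1.le (hcn (N+1))
    have g2 := hc.1
    rw [aux_L] at g2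
    push_cast at g2
    have g3 := mul_le_mul_of_nonneg_left g2 hpos.le
    have g4 : a * rnwC f (N+1) ≤ (1 - 3 * a) / 8 := by
      have := hc.2
      have := hcn (N+1)
      nlinarith
    have g5 := mul_le_mul_of_nonneg_left g4 hpos.le
    nlinarith
  have h3 : (1 - 3 * a) / 2 * s ≤ s * (rnwL f N - s * Q N - (2 * a * rnwL f N + (1 - 3 * a) / 4)) := by
    rw [mul_comm]
    refine mul_le_mul_of_nonneg_left ?_ hpos.le
    nlinarith
  change _ ≤ s * (rnwL f N - s * Q N) - 2 * rnwC f (N + 1)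
  linarith

lemma aux_ne (f : ℕ → ℝ) (hf : ∀ n, 0 ≤ f n) (hs : HasSum f 1)
    (haper : ∀ d : ℕ, (∀ n, 1 ≤ n → 0 < f n → d ∣ n) → d = 1) (z : ℂ) (hz : ‖z‖ ≤ 1)
    (h : ∑' n, (f n : ℂ) * z ^ n = 1) : z = 1 := by
  have hsz := aux_summ f hf hs.summable z hz
  have h1 : HasSum (fun n => f n * (z ^ n).re) 1 := by
    have := Complex.hasSum_re (h ▸ hsz.hasSum)
    simpa using this
  have hre : ∀ n, (z ^ n).re ≤ 1 := fun n =>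
    (Complex.re_le_norm _).trans (by rw [norm_pow]; exact pow_le_one₀ (norm_nonneg _) hz)
  have h2 : HasSum (fun n => f n * (1 - (z ^ n).re)) 0 := by
    have := hs.sub h1
    simpa [mul_sub] using this
  have h3 := (hasSum_zero_iff_of_nonneg
    (fun n => mul_nonneg (hf n) (by linarith [hre n]))).1 h2
  have h4 : orderOf z = 1 := by
    refine haper _ fun n _ hn => ?_
    rw [orderOf_dvd_iff_pow_eq_one]
    have := congrFun h3 n
    simp only [Pi.zero_apply, mul_eq_zero] at this
    have hr : (z ^ n).re = 1 := by
      rcases this with h | h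
      · linarith
      · linarith
    have hn1 : ‖z ^ n‖ ≤ 1 := by rw [norm_pow]; exact pow_le_one₀ (norm_nonneg _) hz
    have hsq : (z ^ n).re ^ 2 + (z ^ n).im ^ 2 ≤ 1 := by
      have := Complex.sq_norm (z ^ n)
      rw [Complex.normSq_apply] at this
      nlinarith [norm_nonneg (z ^ n)]
    have him : (z ^ n).im = 0 := by
      rw [hr] at hsq
      have : (z ^ n).im ^ 2 = 0 := le_antisymm (by linarith) (sq_nonneg _)
      exact pow_eq_zero_iff (two_ne_zero) |>.1 this
    exact Complex.ext (by simp [hr]) (by simp [him])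
  exact orderOf_eq_one_iff.1 h4

lemma aux_all (f : ℕ → ℝ) (hf : ∀ n, 0 ≤ f n) (hf0 : f 0 = 0) (hs : HasSum f 1)
    (haper : ∀ d : ℕ, (∀ n, 1 ≤ n → 0 < f n → d ∣ n) → d = 1)
    (a : ℝ) (ha0 : 0 < a) (ha : a < 1 / 3)
    (hev : ∀ᶠ N : ℕ in atTop, (N : ℝ) * rnwC f N ≤ a * rnwL f N) :
    ∃ δ > 0, ∀ z : ℂ, ‖z‖ ≤ 1 →
      δ * ‖1 - z‖ ≤ ‖1 - ∑' n, (f n : ℂ) * z ^ n‖ := by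
  obtain ⟨ε, hε, δ, hδ, h⟩ := aux_near f hf hf0 hs a ha0 ha hev
  have hcont : ContinuousOn (fun z : ℂ => ‖1 - ∑' n, (f n : ℂ) * z ^ n‖)
      (Metric.closedBall 0 1) := by
    refine (continuousOn_const.sub ?_).norm
    refine continuousOn_tsum (u := f) (fun n => by fun_prop) hs.summable fun n z hz => ?_
    rw [norm_mul, norm_pow, Complex.norm_real, Real.norm_of_nonneg (hf n)]
    exact mul_le_of_le_one_right (hf n) (pow_le_one₀ (norm_nonneg _) (by simpa using hz))
  have hK : IsCompact (Metric.closedBall (0:ℂ) 1 ∩ {z | ε ≤ ‖1 - z‖}) :=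
    (isCompact_closedBall _ _).inter_right (isClosed_le continuous_const (by fun_prop))
  obtain ⟨η, hη, hη2⟩ : ∃ η > 0, ∀ z ∈ Metric.closedBall (0:ℂ) 1 ∩ {z | ε ≤ ‖1 - z‖},
      η ≤ ‖1 - ∑' n, (f n : ℂ) * z ^ n‖ := by
    rcases (Metric.closedBall (0:ℂ) 1 ∩ {z | ε ≤ ‖1 - z‖}).eq_empty_or_nonempty with he | hne
    · exact ⟨1, one_pos, by simp [he]⟩
    · obtain ⟨x, hx, hmin⟩ := hK.exists_isMinOn hne (hcont.mono Set.inter_subset_left)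
      refine ⟨_, ?_, fun z hz => hmin hz⟩
      simp only [gt_iff_lt, norm_pos_iff]
      intro h0
      have := aux_ne f hf hs haper x (by simpa using hx.1) (sub_eq_zero.1 h0).symm
      have h2 := hx.2
      simp [this] at h2
      linarith
  refine ⟨min δ (η / 2), by positivity, fun z hz => ?_⟩
  rcases lt_or_ge (‖1 - z‖) ε with hl | hg
  · exact (mul_le_mul_of_nonneg_right (min_le_left _ _) (norm_nonneg _)).trans (h z hz hl)
  · refine le_trans ?_ (hη2 z ⟨by simpa using hz, hg⟩)
    have : ‖1 - z‖ ≤ 2 := (norm_sub_le _ _).trans (by rw [norm_one]; linarith)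
    calc min δ (η / 2) * ‖1 - z‖ ≤ η / 2 * 2 :=
          mul_le_mul (min_le_right _ _) this (norm_nonneg _) (by positivity)
      _ = η := by ring

open MeasureTheory in
lemma aux_parseval (b : ℕ → ℂ) (M : ℕ) (B : ℝ) (hB : 0 ≤ B)
    (h : ∀ z : ℂ, ‖z‖ = 1 → ‖∑ n ∈ range M, b n * z ^ n‖ ≤ B) :
    ∑ n ∈ range M, ‖b n‖ ^ 2 ≤ B ^ 2 := by
  have : Fact ((0:ℝ) < 1) := ⟨one_pos⟩
  let P : C(AddCircle (1:ℝ), ℂ) := ∑ n ∈ range M, b n • fourier (n : ℤ)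
  have hP : ‖P‖ ≤ B := by
    rw [ContinuousMap.norm_le _ hB]
    intro x
    have e : P x = ∑ n ∈ range M, b n * ((AddCircle.toCircle x : Circle) : ℂ) ^ n := by
      simp [P, ContinuousMap.sum_apply, fourier_apply, AddCircle.toCircle_nsmul]
    rw [e]
    exact h _ (Circle.norm_coe _)
  have ho : Orthonormal ℂ (fun n : ℕ => fourierLp (T := (1:ℝ)) 2 (n : ℤ)) :=
    (orthonormal_fourier (T := (1:ℝ))).comp (fun n : ℕ => (n : ℤ)) Nat.cast_injective
  set v : ℕ → Lp ℂ 2 (AddCircle.haarAddCircle (T := (1:ℝ))) :=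
    fun n : ℕ => fourierLp (T := (1:ℝ)) 2 (n : ℤ) with hv
  have e1 : ContinuousMap.toLp 2 AddCircle.haarAddCircle ℂ P = ∑ n ∈ range M, b n • v n := by
    simp only [P, map_sum, map_smul]
    rfl
  have h1 : ‖ContinuousMap.toLp 2 AddCircle.haarAddCircle ℂ P‖ ≤ B := by
    refine (ContinuousLinearMap.le_opNorm _ _).trans ?_
    have := ContinuousMap.toLp_norm_le (p := 2) (E := ℂ) (𝕜 := ℂ)
      (AddCircle.haarAddCircle (T := (1:ℝ)))
    have h1 : measureUnivNNReal (AddCircle.haarAddCircle (T := (1:ℝ))) = 1 := by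
      simp [measureUnivNNReal]
    rw [h1] at this
    simp only [NNReal.coe_one] at this
    calc _ ≤ 1 * ‖P‖ := mul_le_mul_of_nonneg_right (by simpa using this) (norm_nonneg _)
      _ ≤ B := by linarith
  have h2 : ‖∑ n ∈ range M, b n • v n‖ ^ 2 = ∑ n ∈ range M, ‖b n‖ ^ 2 := by
    have := ho.inner_sum b b (range M)
    rw [inner_self_eq_norm_sq_to_K] at this
    have h3 : ((‖∑ n ∈ range M, b n • v n‖ ^ 2 : ℝ) : ℂ)
        = ((∑ n ∈ range M, ‖b n‖ ^ 2 : ℝ) : ℂ) := by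
      push_cast
      refine Eq.trans this ?_
      refine sum_congr rfl fun n _ => ?_
      rw [Complex.conj_mul']
    exact_mod_cast h3
  rw [← h2, ← e1]
  exact pow_le_pow_left₀ (norm_nonneg _) h1 2

lemma aux_hardy (g : ℕ → ℝ) (C : ℝ) (hg : ∀ n, |g n| ≤ C) (B : ℝ) (hB : 0 ≤ B)
    (h : ∀ z : ℂ, ‖z‖ < 1 → ‖∑' n, (g n : ℂ) * z ^ n‖ ≤ B) :
    Summable (fun n => g n ^ 2) := by
  have key : ∀ r : ℝ, 0 < r → r < 1 → ∀ K : ℕ,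
      ∑ n ∈ range K, g n ^ 2 * (r ^ n) ^ 2 ≤ (B + 1) ^ 2 := by
    intro r hr0 hr1 K
    have hs : Summable (fun n => C * r ^ n) :=
      (summable_geometric_of_lt_one hr0.le hr1).mul_left C
    have ht := tendsto_sum_nat_add (fun n => C * r ^ n)
    obtain ⟨M0, hM0⟩ := eventually_atTop.1 (ht.eventually (gt_mem_nhds one_pos))
    set M := max K M0
    have hM := hM0 M (le_max_right _ _)
    have hbd : ∀ z : ℂ, ‖z‖ = 1 → ∀ n, ‖(g n : ℂ) * (r * z) ^ n‖ ≤ C * r ^ n := by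
      intro z hz n
      rw [norm_mul, norm_pow, norm_mul, hz, Complex.norm_real, Complex.norm_real, mul_one,
        Real.norm_of_nonneg hr0.le]
      exact mul_le_mul_of_nonneg_right (hg n) (by positivity)
    have hp := aux_parseval (fun n => (g n : ℂ) * (r : ℂ) ^ n) M (B + 1) (by linarith) ?_
    · refine le_trans ?_ hp
      refine (sum_le_sum_of_subset_of_nonneg (range_subset_range.2 (le_max_left K M0))
        fun _ _ _ => by positivity).trans (le_of_eq ?_)
      refine sum_congr rfl fun n _ => ?_
      rw [norm_mul, norm_pow, Complex.norm_real, Complex.norm_real, mul_pow,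
        Real.norm_of_nonneg hr0.le, Real.norm_eq_abs, sq_abs]
    · intro z hz
      have hsum : Summable (fun n => (g n : ℂ) * (r * z) ^ n) :=
        Summable.of_norm_bounded hs (hbd z hz)
      have e := hsum.sum_add_tsum_nat_add M
      have e1 : ∑ n ∈ range M, (g n : ℂ) * (r : ℂ) ^ n * z ^ n
          = ∑' n, (g n : ℂ) * (r * z) ^ n - ∑' n, (g (n + M) : ℂ) * (r * z) ^ (n + M) := by
        rw [← e, add_sub_cancel_right]
        exact sum_congr rfl fun n _ => by ring
      rw [e1]
      have hlt : ‖(r : ℂ) * z‖ < 1 := by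
        rw [norm_mul, hz, Complex.norm_real, Real.norm_of_nonneg hr0.le]; linarith
      refine (norm_sub_le _ _).trans (add_le_add (h _ hlt) ?_)
      refine le_trans ?_ hM.le
      exact tsum_of_norm_bounded ((summable_nat_add_iff M).2 hs).hasSum fun n => hbd z hz _
  refine summable_of_sum_range_le (c := (B + 1) ^ 2) (fun n => sq_nonneg _) fun K => ?_
  have hcont : Continuous (fun r : ℝ => ∑ n ∈ range K, g n ^ 2 * (r ^ n) ^ 2) := by fun_prop
  have ht : Tendsto (fun r : ℝ => ∑ n ∈ range K, g n ^ 2 * (r ^ n) ^ 2)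
      (nhdsWithin 1 (Set.Iio 1)) (nhds (∑ n ∈ range K, g n ^ 2)) := by
    have := (hcont.tendsto 1).mono_left (nhdsWithin_le_nhds (s := Set.Iio 1))
    simpa using this
  refine le_of_tendsto ht ?_
  filter_upwards [Ioo_mem_nhdsLT (show (0:ℝ) < 1 by norm_num)] with r hr
  exact key r hr.1 hr.2 K

lemma aux_ubd (f u : ℕ → ℝ)
    (hfpos : ∀ n, 0 ≤ f n) (hfsum : HasSum f 1)
    (hu0 : u 0 = 1)
    (hu : ∀ n, 1 ≤ n → u n = ∑ k ∈ Finset.Icc 1 n, f k * u (n - k)) (n : ℕ) :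
    0 ≤ u n ∧ u n ≤ 1 := by
  induction n using Nat.strong_induction_on with
  | _ n ih =>
    rcases Nat.eq_zero_or_pos n with rfl | hn
    · simp [hu0]
    · rw [hu n hn]
      have hk : ∀ k ∈ Finset.Icc 1 n, 0 ≤ u (n - k) ∧ u (n - k) ≤ 1 := fun k hk => by
        rw [mem_Icc] at hk
        exact ih _ (by omega)
      refine ⟨sum_nonneg fun k hk' => mul_nonneg (hfpos k) (hk k hk').1, ?_⟩
      calc _ ≤ ∑ k ∈ Finset.Icc 1 n, f k :=
            sum_le_sum fun k hk' => mul_le_of_le_one_right (hfpos k) (hk k hk').2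
        _ ≤ 1 := sum_le_hasSum _ (fun k _ => hfpos k) hfsum

lemma aux_renewal (f u : ℕ → ℝ)
    (hf0 : f 0 = 0) (hfpos : ∀ n, 0 ≤ f n) (hfsum : HasSum f 1)
    (hu0 : u 0 = 1)
    (hu : ∀ n, 1 ≤ n → u n = ∑ k ∈ Finset.Icc 1 n, f k * u (n - k)) (z : ℂ) (hz : ‖z‖ < 1) :
    Summable (fun n => (u n : ℂ) * z ^ n) ∧
    (1 - ∑' n, (f n : ℂ) * z ^ n) * ∑' n, (u n : ℂ) * z ^ n = 1 := by
  have hub := aux_ubd f u hfpos hfsum hu0 hu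
  have hU : Summable (fun n => ‖(u n : ℂ) * z ^ n‖) := by
    refine Summable.of_nonneg_of_le (fun _ => norm_nonneg _) (fun n => ?_)
      (summable_geometric_of_lt_one (norm_nonneg z) hz)
    rw [norm_mul, norm_pow, Complex.norm_real, Real.norm_of_nonneg (hub n).1]
    exact mul_le_of_le_one_left (by positivity) (hub n).2
  have hF : Summable (fun n => ‖(f n : ℂ) * z ^ n‖) := by
    refine Summable.of_nonneg_of_le (fun _ => norm_nonneg _) (fun n => ?_) hfsum.summable
    rw [norm_mul, norm_pow, Complex.norm_real, Real.norm_of_nonneg (hfpos n)]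
    exact mul_le_of_le_one_right (hfpos n) (pow_le_one₀ (norm_nonneg _) hz.le)
  refine ⟨hU.of_norm, ?_⟩
  have hprod := tsum_mul_tsum_eq_tsum_sum_range_of_summable_norm hF hU
  have hconv : ∀ n, ∑ k ∈ range (n + 1), (f k : ℂ) * z ^ k * ((u (n - k) : ℂ) * z ^ (n - k))
      = if n = 0 then 0 else (u n : ℂ) * z ^ n := by
    intro n
    split_ifs with h
    · subst h; simp [hf0]
    · rw [hu n (by omega)]
      push_cast
      rw [sum_mul, sum_range_eq_add_Ico _ (by omega : 0 < n + 1)]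
      simp only [hf0, Complex.ofReal_zero, zero_mul, zero_add]
      refine sum_congr (by ext; simp) fun k hk => ?_
      rw [mem_Icc] at hk
      have : z ^ n = z ^ k * z ^ (n - k) := by rw [← pow_add]; congr 1; omega
      rw [this]; ring
  rw [sub_mul, hprod, tsum_congr hconv, hU.of_norm.tsum_eq_zero_add,
    tsum_eq_zero_add' (f := fun n => if n = 0 then (0:ℂ) else (u n : ℂ) * z ^ n)]
  · simp [hu0]
  · simpa using (summable_nat_add_iff 1).2 hU.of_norm

lemma aux_G (f u g : ℕ → ℝ)
    (hf0 : f 0 = 0) (hfpos : ∀ n, 0 ≤ f n) (hfsum : HasSum f 1)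
    (hu0 : u 0 = 1)
    (hu : ∀ n, 1 ≤ n → u n = ∑ k ∈ Finset.Icc 1 n, f k * u (n - k))
    (g0 : g 0 = 1) (g1 : ∀ n, g (n + 1) = u (n + 1) - u n) (δ : ℝ) (hδ : 0 < δ)
    (hlow : ∀ z : ℂ, ‖z‖ ≤ 1 → δ * ‖1 - z‖ ≤ ‖1 - ∑' n, (f n : ℂ) * z ^ n‖) :
    ∀ z : ℂ, ‖z‖ < 1 → ‖∑' n, (g n : ℂ) * z ^ n‖ ≤ 1 / δ := by
  intro z hz
  obtain ⟨hU, h1⟩ := aux_renewal f u hf0 hfpos hfsum hu0 hu z hz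
  have hU1 := (summable_nat_add_iff 1).2 hU
  have e : ∀ n, (g (n+1) : ℂ) * z ^ (n+1)
      = (u (n+1) : ℂ) * z ^ (n+1) - z * ((u n : ℂ) * z ^ n) := fun n => by
    rw [g1]; push_cast; ring
  have hsg : Summable (fun n => (g (n+1) : ℂ) * z ^ (n+1)) :=
    (hU1.sub (hU.mul_left z)).congr fun n => (e n).symm
  have hGe : ∑' n, (g n : ℂ) * z ^ n = (1 - z) * ∑' n, (u n : ℂ) * z ^ n := by
    have hsg' : Summable (fun n => (g n : ℂ) * z ^ n) := (summable_nat_add_iff 1).1 hsg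
    have hA : ∑' n, ((u (n+1) : ℂ) * z ^ (n+1) - z * ((u n : ℂ) * z ^ n))
        = ∑' n, (u (n+1) : ℂ) * z ^ (n+1) - z * ∑' n, (u n : ℂ) * z ^ n := by
      rw [← tsum_mul_left]
      exact hU1.tsum_sub (hU.mul_left z)
    rw [hsg'.tsum_eq_zero_add, tsum_congr e, hA]
    have := hU.tsum_eq_zero_add
    rw [g0]
    rw [hu0] at this
    simp only [Complex.ofReal_one, pow_zero, mul_one] at this ⊢
    linear_combination -this
  rw [hGe, norm_mul, le_div_iff₀ hδ]
  have h2 := congrArg norm h1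
  rw [norm_mul, norm_one] at h2
  rw [← h2]
  have := mul_le_mul_of_nonneg_right (hlow z hz.le) (norm_nonneg (∑' n, (u n : ℂ) * z ^ n))
  linarith

/-- If `u` is an aperiodic recurrent renewal sequence with lifetime
distribution `f` and `limsup_N N·c(N)/L(N) < 1/(√5+1)`, then
`∑_{k=1}^{∞} (u k − u (k+1))² < ∞`. -/
theorem stmt3 (f u : ℕ → ℝ)
    (hf0 : f 0 = 0) (hfpos : ∀ n, 0 ≤ f n) (hfsum : HasSum f 1)
    (hu0 : u 0 = 1)
    (hu : ∀ n, 1 ≤ n → u n = ∑ k ∈ Finset.Icc 1 n, f k * u (n - k))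
    (haper : ∀ d : ℕ, (∀ n, 1 ≤ n → 0 < f n → d ∣ n) → d = 1)
    (hlim : Filter.limsup (fun N : ℕ => (N : ℝ) * rnwC f N / rnwL f N) Filter.atTop
      < 1 / (Real.sqrt 5 + 1)) :
    Summable (fun k : ℕ => (u (k + 1) - u (k + 2)) ^ 2) := by
  have hcn := aux_c_nonneg f hfpos
  have hc_anti : Antitone (rnwC f) := antitone_nat_of_succ_le fun n => by
    rw [aux_c_succ f hfsum.summable n]; linarith [hfpos n]
  have hLge : ∀ N : ℕ, (N : ℝ) * rnwC f N ≤ rnwL f N := by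
    intro N
    rw [aux_L']
    calc (N : ℝ) * rnwC f N = ∑ k ∈ range N, rnwC f N := by simp
      _ ≤ _ := sum_le_sum fun k hk => hc_anti (by rw [mem_range] at hk; omega)
  have hL0 : ∀ N, 0 ≤ rnwL f N := fun N => by
    rw [aux_L']; exact sum_nonneg fun _ _ => hcn _
  have hbdd : IsBoundedUnder (· ≤ ·) atTop (fun N : ℕ => (N : ℝ) * rnwC f N / rnwL f N) :=
    isBoundedUnder_of ⟨1, fun N => div_le_one_of_le₀ (hLge N) (hL0 N)⟩
  have hev := eventually_lt_of_limsup_lt hlim hbdd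
  have h5 : (2:ℝ) < Real.sqrt 5 := by
    rw [Real.lt_sqrt (by norm_num)]; norm_num
  have ha0 : 0 < 1 / (Real.sqrt 5 + 1) := by positivity
  have ha : 1 / (Real.sqrt 5 + 1) < 1 / 3 := by
    apply one_div_lt_one_div_of_lt <;> linarith
  have hev' : ∀ᶠ N : ℕ in atTop, (N : ℝ) * rnwC f N ≤ 1 / (Real.sqrt 5 + 1) * rnwL f N := by
    filter_upwards [hev] with N hN
    rcases (hL0 N).eq_or_lt with h | h
    · have := hLge N
      rw [← h] at this ⊢
      simpa using this
    · exact ((div_lt_iff₀ h).1 hN).le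
  obtain ⟨δ, hδ, hlow⟩ := aux_all f hfpos hf0 hfsum haper _ ha0 ha hev'
  have hub := aux_ubd f u hfpos hfsum hu0 hu
  let g : ℕ → ℝ := fun n => if n = 0 then 1 else u n - u (n - 1)
  have hg : ∀ n, |g n| ≤ 1 := by
    intro n
    by_cases h : n = 0
    · simp [g, h]
    · simp only [g, h, if_false]
      rw [abs_le]
      constructor <;> linarith [(hub n).1, (hub n).2, (hub (n-1)).1, (hub (n-1)).2]
  have hG := aux_G f u g hf0 hfpos hfsum hu0 hu (by simp [g]) (fun n => by simp [g]) δ hδ hlow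
  have hfin := aux_hardy g 1 hg (1 / δ) (by positivity) hG
  have := (summable_nat_add_iff 2).2 hfin
  refine this.congr fun k => ?_
  simp only [g]
  rw [if_neg (by omega), show k + 2 - 1 = k + 1 by omega]
  ring
end

section
/- Let c : {1,2,...} → (0,∞) be nonincreasing with L(N) = ∑_{k=1}^{N} c(k) → ∞ as N → ∞. Then ∑_{k=1}^{N} c(k)/L(k) ∼ log L(N) as N → ∞, i.e. the ratio of the two sides tends to 1. -/
open Filter Finset

theorem aux10 (c : ℕ → ℝ)
    (hpos : ∀ n : ℕ, 1 ≤ n → 0 < c n)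
    (hmono : ∀ m n : ℕ, 1 ≤ m → m ≤ n → c n ≤ c m) (N : ℕ) (hN : 1 ≤ N) :
    0 < ∑ k ∈ Finset.Icc 1 N, c k ∧
    Real.log (∑ k ∈ Finset.Icc 1 N, c k) - Real.log (c 1) + c 1 / (∑ k ∈ Finset.Icc 1 N, c k)
      ≤ (∑ k ∈ Finset.Icc 1 N, c k / ∑ j ∈ Finset.Icc 1 k, c j) ∧
    (∑ k ∈ Finset.Icc 1 N, c k / ∑ j ∈ Finset.Icc 1 k, c j) ≤
      1 + Real.log (∑ k ∈ Finset.Icc 1 N, c k) - Real.log (c 1) := by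
  induction N, hN using Nat.le_induction with
  | base =>
    have := hpos 1 le_rfl
    simp [this, this.ne']
  | succ n hn ih =>
    obtain ⟨h0, h1, h2⟩ := ih
    rw [Finset.sum_Icc_succ_top (by omega) (fun k => c k / ∑ j ∈ Finset.Icc 1 k, c j)]
    rw [Finset.sum_Icc_succ_top (by omega) c]
    set L := ∑ k ∈ Finset.Icc 1 n, c k
    set S := ∑ k ∈ Finset.Icc 1 n, c k / ∑ j ∈ Finset.Icc 1 k, c j
    have hx := hpos (n+1) (by omega)
    have hx1 := hmono 1 (n+1) le_rfl (by omega)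
    set x := c (n+1)
    have hLx : 0 < L + x := by linarith
    have e1 : Real.log (L + x) - Real.log L ≤ x / L := by
      rw [← Real.log_div hLx.ne' h0.ne']
      have := Real.log_le_sub_one_of_pos (div_pos hLx h0)
      have h : (L + x) / L - 1 = x / L := by field_simp; ring
      linarith
    have e2 : Real.log L - Real.log (L + x) ≤ - (x / (L + x)) := by
      rw [← Real.log_div h0.ne' hLx.ne']
      have := Real.log_le_sub_one_of_pos (div_pos h0 hLx)
      have h : L / (L + x) - 1 = -(x / (L + x)) := by field_simp; ring
      linarith
    have e3 : x / L - x / (L + x) ≤ c 1 / L - c 1 / (L + x) := by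
      have a : x / L - x / (L + x) = x * (x / (L * (L + x))) := by field_simp; ring
      have b : c 1 / L - c 1 / (L + x) = c 1 * (x / (L * (L + x))) := by field_simp; ring
      rw [a, b]
      gcongr
    refine ⟨hLx, by linarith, by linarith⟩

/-- If `c` is a nonincreasing positive sequence (indexed by `n ≥ 1`)
whose partial sums `L(N) = ∑_{k=1}^N c(k)` tend to infinity, then
`∑_{k=1}^{N} c(k)/L(k) ∼ log L(N)` as `N → ∞`. -/
theorem stmt10 (c : ℕ → ℝ)
    (hpos : ∀ n : ℕ, 1 ≤ n → 0 < c n)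
    (hmono : ∀ m n : ℕ, 1 ≤ m → m ≤ n → c n ≤ c m)
    (hL : Filter.Tendsto (fun N : ℕ => ∑ k ∈ Finset.Icc 1 N, c k) Filter.atTop
      Filter.atTop) :
    Filter.Tendsto (fun N : ℕ =>
        (∑ k ∈ Finset.Icc 1 N, c k / ∑ j ∈ Finset.Icc 1 k, c j) /
          Real.log (∑ k ∈ Finset.Icc 1 N, c k))
      Filter.atTop (nhds 1) := by
  have hlog := Real.tendsto_log_atTop.comp hL
  have t : ∀ a : ℝ, Tendsto (fun N : ℕ => 1 + a / Real.log (∑ k ∈ Finset.Icc 1 N, c k))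
      atTop (nhds 1) := fun a => by
    simpa using (hlog.const_div_atTop a).const_add 1
  refine tendsto_of_tendsto_of_tendsto_of_le_of_le' (t (-Real.log (c 1)))
    (t (1 - Real.log (c 1))) ?_ ?_
  all_goals
    filter_upwards [hlog.eventually_gt_atTop 0, eventually_ge_atTop 1] with N h hN
    obtain ⟨h0, h1, h2⟩ := aux10 c hpos hmono N hN
    have h3 := div_pos (hpos 1 le_rfl) h0
    simp only [Function.comp] at h
    rw [one_add_div h.ne']
    gcongr
    linarith
end

section
/- Let u be an aperiodic recurrent renewal sequence with lifetime distribution f, and suppose the partial-sum sequence a(n) = ∑_{k=1}^{n} u(k) is regularly varying of index t, i.e. for every λ > 0, a(⌊λn⌋)/a(n) → λ^t as n → ∞, where √5/(√5+1) < t ≤ 1. Then limsup_{N→∞} N·c(N)/L(N) < 1/(√5+1), and consequently u is smooth. -/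
open Filter Finset

structure Rnw (f u : ℕ → ℝ) : Prop where
  f0 : f 0 = 0
  fpos : ∀ n, 0 ≤ f n
  fsum : HasSum f 1
  u0 : u 0 = 1
  hu : ∀ n, 1 ≤ n → u n = ∑ k ∈ Finset.Icc 1 n, f k * u (n - k)

/-- full partial sum including zero -/
noncomputable def rnwS (u : ℕ → ℝ) (n : ℕ) : ℝ := ∑ k ∈ Finset.range (n + 1), u k

namespace Rnw

variable {f u : ℕ → ℝ}

lemma summ (h : Rnw f u) : Summable f := h.fsum.summable

lemma summ' (h : Rnw f u) (N : ℕ) : Summable (fun k => f (N + k)) := by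
  have := (summable_nat_add_iff N).2 h.summ
  simpa [add_comm] using this

lemma c_succ (h : Rnw f u) (N : ℕ) : rnwC f N = f N + rnwC f (N + 1) := by
  unfold rnwC
  rw [(h.summ' N).tsum_eq_zero_add]
  simp only [add_zero, add_right_inj]
  congr 1; ext k; congr 1; ring

lemma c_nonneg (h : Rnw f u) (N : ℕ) : 0 ≤ rnwC f N := tsum_nonneg fun _ => h.fpos _

lemma c_anti (h : Rnw f u) : Antitone (rnwC f) :=
  antitone_nat_of_succ_le fun n => by rw [h.c_succ n]; linarith [h.fpos n]

lemma c_zero (h : Rnw f u) : rnwC f 0 = 1 := by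
  unfold rnwC; simpa using h.fsum.tsum_eq

lemma c_one (h : Rnw f u) : rnwC f 1 = 1 := by
  have := h.c_succ 0
  rw [h.c_zero, h.f0] at this; simpa using this.symm

lemma c_le_one (h : Rnw f u) (N : ℕ) : rnwC f N ≤ 1 := by
  rw [← h.c_zero]; exact h.c_anti (Nat.zero_le _)

lemma L_eq (f : ℕ → ℝ) (N : ℕ) : rnwL f N = ∑ n ∈ Finset.range N, rnwC f (n + 1) := by
  unfold rnwL
  rw [Finset.range_eq_Ico, Finset.sum_Ico_add' (fun n => rnwC f n) 0 N 1]
  rfl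

lemma L_succ (f : ℕ → ℝ) (N : ℕ) : rnwL f (N + 1) = rnwL f N + rnwC f (N + 1) := by
  simp [L_eq, Finset.sum_range_succ]

lemma L_mono (h : Rnw f u) : Monotone (rnwL f) :=
  monotone_nat_of_le_succ fun n => by rw [L_succ]; linarith [h.c_nonneg (n+1)]

lemma L_one_le (h : Rnw f u) {N : ℕ} (hN : 1 ≤ N) : 1 ≤ rnwL f N := by
  have : rnwL f 1 = 1 := by simp [L_eq, h.c_one]
  rw [← this]; exact h.L_mono hN

lemma L_nonneg (h : Rnw f u) (N : ℕ) : 0 ≤ rnwL f N := by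
  rw [L_eq]; exact Finset.sum_nonneg fun _ _ => h.c_nonneg _

lemma L_sub (h : Rnw f u) (m k : ℕ) : k * rnwC f (m + k) ≤ rnwL f (m + k) - rnwL f m := by
  induction k with
  | zero => simp
  | succ k ih =>
    have e : rnwL f (m + (k + 1)) = rnwL f (m + k) + rnwC f (m + (k + 1)) := L_succ f (m + k)
    rw [e]
    have : rnwC f (m + (k + 1)) ≤ rnwC f (m + k) := h.c_anti (by omega)
    have hk : (0:ℝ) ≤ k := by positivity
    push_cast
    nlinarith

lemma u_nonneg (h : Rnw f u) (n : ℕ) : 0 ≤ u n := by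
  induction n using Nat.strong_induction_on with
  | _ n ih =>
    rcases Nat.eq_zero_or_pos n with rfl | hn
    · simp [h.u0]
    · rw [h.hu n hn]
      refine Finset.sum_nonneg fun k hk => mul_nonneg (h.fpos _) (ih _ ?_)
      simp at hk; omega

/-- convolution form -/
lemma u_conv (h : Rnw f u) (n : ℕ) : u (n + 1) = ∑ k ∈ Finset.range (n + 1), u k * f (n + 1 - k) := by
  rw [h.hu (n+1) (by omega)]
  rw [← Finset.sum_range_reflect]
  have : Finset.Icc 1 (n+1) = Finset.Ico (0+1) (n+1+1) := rfl
  rw [this, ← Finset.sum_Ico_add' (fun k => f k * u (n + 1 - k)) 0 (n+1) 1, ← Finset.range_eq_Ico]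
  refine Finset.sum_congr rfl fun k hk => ?_
  simp at hk
  rw [mul_comm]
  congr 2 <;> omega

lemma conv_one (h : Rnw f u) (n : ℕ) :
    ∑ k ∈ Finset.range (n + 1), u k * rnwC f (n - k + 1) = 1 := by
  induction n with
  | zero => simp [h.u0, h.c_one]
  | succ n ih =>
    rw [Finset.sum_range_succ]
    simp only [Nat.sub_self, zero_add, h.c_one, mul_one]
    rw [h.u_conv n, ← Finset.sum_add_distrib, ← ih]
    refine Finset.sum_congr rfl fun k hk => ?_
    simp at hk
    have := h.c_succ (n - k + 1)
    have e : n + 1 - k = n - k + 1 := by omega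
    rw [e, this]; ring

lemma u_le_one (h : Rnw f u) (n : ℕ) : u n ≤ 1 := by
  rw [← h.conv_one n, Finset.sum_range_succ]
  simp only [Nat.sub_self, zero_add, h.c_one, mul_one]
  have : 0 ≤ ∑ k ∈ Finset.range n, u k * rnwC f (n - k + 1) :=
    Finset.sum_nonneg fun _ _ => mul_nonneg (h.u_nonneg _) (h.c_nonneg _)
  linarith

lemma conv_L (h : Rnw f u) (n : ℕ) :
    ∑ k ∈ Finset.range (n + 1), u k * rnwL f (n - k + 1) = n + 1 := by
  induction n with
  | zero => simp [h.u0, L_eq, h.c_one]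
  | succ n ih =>
    rw [Finset.sum_range_succ]
    have h1 := h.conv_one (n+1)
    rw [Finset.sum_range_succ] at h1
    have e : ∀ k ∈ Finset.range (n+1), u k * rnwL f (n + 1 - k + 1) =
        u k * rnwL f (n - k + 1) + u k * rnwC f (n + 1 - k + 1) := by
      intro k hk
      simp at hk
      have e : n + 1 - k = n - k + 1 := by omega
      rw [e, L_succ f (n - k + 1)]; ring
    rw [Finset.sum_congr rfl e, Finset.sum_add_distrib, ih]
    have e2 : rnwL f (n + 1 - (n + 1) + 1) = rnwC f (n + 1 - (n + 1) + 1) := by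
      simp [L_eq]
    rw [e2, Nat.cast_succ]; linarith

lemma S_eq (h : Rnw f u) (n : ℕ) : rnwS u n = 1 + rnwA u n := by
  unfold rnwS rnwA
  rw [Finset.sum_range_succ', h.u0, add_comm, Finset.range_eq_Ico, Finset.sum_Ico_add' (fun n => u n) 0 n 1]
  rfl

lemma S_mono (h : Rnw f u) : Monotone (rnwS u) :=
  monotone_nat_of_le_succ fun n => by
    unfold rnwS
    rw [Finset.sum_range_succ _ (n+1)]; linarith [h.u_nonneg (n+1)]

lemma S_one_le (h : Rnw f u) (n : ℕ) : 1 ≤ rnwS u n := by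
  have : rnwS u 0 = 1 := by simp [rnwS, h.u0]
  rw [← this]; exact h.S_mono (Nat.zero_le _)

lemma A_mono (h : Rnw f u) : Monotone (rnwA u) := fun m n hmn => by
  have := h.S_mono hmn
  rw [h.S_eq, h.S_eq] at this; linarith

/-- `A(n) L(n+1) ≥ n+1` -/
lemma SL_ge (h : Rnw f u) (n : ℕ) : (n : ℝ) + 1 ≤ rnwS u n * rnwL f (n + 1) := by
  rw [← h.conv_L n, rnwS, Finset.sum_mul]
  refine Finset.sum_le_sum fun k _ => mul_le_mul_of_nonneg_left (h.L_mono (by omega)) (h.u_nonneg _)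

lemma SL_ge' (h : Rnw f u) (N : ℕ) : (N : ℝ) ≤ rnwS u N * rnwL f N := by
  rcases N with _ | n
  · simp [L_eq]
  · push_cast
    exact (h.SL_ge n).trans (mul_le_mul_of_nonneg_right (h.S_mono (by omega)) (h.L_nonneg _))

lemma SL_le (h : Rnw f u) (n : ℕ) : rnwS u n * rnwL f (n + 1) ≤ 2 * n + 1 := by
  have := h.conv_L (2 * n)
  push_cast at this
  rw [← this, rnwS, Finset.sum_mul]
  calc ∑ i ∈ Finset.range (n+1), u i * rnwL f (n + 1)
      ≤ ∑ i ∈ Finset.range (n+1), u i * rnwL f (2 * n - i + 1) := by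
        refine Finset.sum_le_sum fun k hk => mul_le_mul_of_nonneg_left (h.L_mono ?_) (h.u_nonneg _)
        simp at hk; omega
    _ ≤ _ := by
        refine Finset.sum_le_sum_of_subset_of_nonneg ?_ fun i _ _ => mul_nonneg (h.u_nonneg _) (h.L_nonneg _)
        intro x; simp; omega

lemma S_potter (h : Rnw f u) (N : ℕ) (y : ℝ) (hy : 0 ≤ y) :
    rnwS u ⌊y * N⌋₊ ≤ (2 * y + 1) * rnwS u N := by
  set m := ⌊y * N⌋₊ with hm
  have hmy : (m : ℝ) ≤ y * N := Nat.floor_le (by positivity)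
  have hSN := h.S_one_le N
  rcases le_total m N with hmN | hmN
  · have := h.S_mono hmN
    nlinarith
  · have h1 := h.SL_le m
    have h2 := h.SL_ge N
    have hL : rnwL f (N+1) ≤ rnwL f (m+1) := h.L_mono (by omega)
    have hL1 : 1 ≤ rnwL f (N+1) := h.L_one_le (by omega)
    have hSm := h.S_one_le m
    have h3 : rnwS u m * rnwL f (N+1) ≤ (2 * y + 1) * rnwS u N * rnwL f (N+1) := by
      calc _ ≤ rnwS u m * rnwL f (m+1) := by gcongr
        _ ≤ 2 * m + 1 := h1
        _ ≤ (2 * y + 1) * (N + 1) := by nlinarith [(Nat.cast_nonneg N : (0:ℝ) ≤ N)]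
        _ ≤ (2 * y + 1) * (rnwS u N * rnwL f (N+1)) := by gcongr
        _ = _ := by ring
    exact le_of_mul_le_mul_right h3 (by linarith)

end Rnw

lemma rnw_hasSum_congr {f g : ℕ → ℂ} {a : ℂ} (h : HasSum f a) (e : ∀ k, g k = f k) :
    HasSum g a := by
  have : g = f := funext e
  rwa [this]

lemma rnw_bessel_s13 (e : ℕ → ℂ) (he : Summable fun k => ‖e k‖) (B : ℝ) (hB0 : 0 ≤ B)
    (hB : ∀ z : ℂ, ‖z‖ = 1 → ‖∑' k, e k * z ^ k‖ ≤ B) (n : ℕ) :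
    ∑ k ∈ Finset.range n, ‖e k‖ ^ 2 ≤ B ^ 2 := by
  have : Fact (0 < (1:ℝ)) := ⟨one_pos⟩
  have hsum : Summable (fun k : ℕ => e k • (fourier (k : ℤ) : C(AddCircle (1:ℝ), ℂ))) := by
    refine Summable.of_norm ?_
    simpa [norm_smul, fourier_norm] using he
  set G : C(AddCircle (1:ℝ), ℂ) := ∑' k : ℕ, e k • fourier (k : ℤ) with hG
  have hGs : HasSum (fun k : ℕ => e k • (fourier (k : ℤ) : C(AddCircle (1:ℝ), ℂ))) G := hsum.hasSum
  have hGn : ‖G‖ ≤ B := by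
    rw [ContinuousMap.norm_le _ hB0]
    intro x
    have h1 : HasSum (fun k : ℕ => e k * (fourier 1 x : ℂ) ^ k) (G x) := by
      have := (ContinuousMap.evalCLM ℂ x).hasSum hGs
      change HasSum _ (G x) at this
      convert this using 2 with k
      simp [fourier_apply, ContinuousMap.evalCLM]
      left
      rw [← Circle.coe_pow, ← AddCircle.toCircle_nsmul]
    rw [← h1.tsum_eq]
    apply hB
    rw [fourier_one]
    exact Circle.norm_coe _
  let TL := ContinuousMap.toLp (E := ℂ) 2 (AddCircle.haarAddCircle (T := (1:ℝ))) ℂ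
  have hx : ‖TL G‖ ≤ B := by
    refine (ContinuousLinearMap.le_opNorm _ _).trans ?_
    have : ‖TL‖ ≤ 1 := by
      refine (ContinuousMap.toLp_norm_le _).trans ?_
      simp [MeasureTheory.measureUnivNNReal]
    calc ‖TL‖ * ‖G‖ ≤ 1 * B := by gcongr
      _ = B := one_mul _
  have hcoef : ∀ j : ℕ, inner ℂ (fourierLp (T := (1:ℝ)) 2 (j : ℤ)) (TL G) = e j := by
    intro j
    have h1 : HasSum (fun k : ℕ => inner ℂ (fourierLp (T := (1:ℝ)) 2 (j : ℤ)) (TL (e k • fourier (k : ℤ))))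
        (inner ℂ (fourierLp (T := (1:ℝ)) 2 (j : ℤ)) (TL G)) :=
      (innerSL ℂ (fourierLp (T := (1:ℝ)) 2 (j : ℤ))).hasSum (TL.hasSum hGs)
    have h2 : ∀ k : ℕ, inner ℂ (fourierLp (T := (1:ℝ)) 2 (j : ℤ)) (TL (e k • fourier (k : ℤ)))
        = if k = j then e j else 0 := by
      intro k
      have e1 : TL (e k • fourier (k : ℤ)) = e k • fourierLp (T := (1:ℝ)) 2 (k : ℤ) := by
        rw [map_smul]
      rw [e1, inner_smul_right, (orthonormal_iff_ite.1 (orthonormal_fourier (T := (1:ℝ))))]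
      by_cases hkj : k = j
      · simp [hkj]
      · have : ¬ ((j:ℤ) = k) := by exact_mod_cast (Ne.symm hkj)
        simp [hkj, this]
    simp_rw [h2] at h1
    exact h1.unique (hasSum_ite_eq j (e j))
  have hb := (orthonormal_fourier (T := (1:ℝ))).sum_inner_products_le (TL G)
    (s := (Finset.range n).map Nat.castEmbedding)
  rw [Finset.sum_map] at hb
  simp only [Nat.castEmbedding_apply, hcoef] at hb
  refine hb.trans ?_
  gcongr

namespace Rnw
variable {f u : ℕ → ℝ}

/-- the generating function -/
lemma summable_F (h : Rnw f u) {z : ℂ} (hz : ‖z‖ ≤ 1) : Summable fun n => ‖(f n : ℂ) * z ^ n‖ := by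
  refine Summable.of_nonneg_of_le (fun _ => norm_nonneg _) (fun n => ?_) h.summ
  rw [norm_mul, norm_pow, Complex.norm_real, Real.norm_of_nonneg (h.fpos n)]
  exact mul_le_of_le_one_right (h.fpos n) (pow_le_one₀ (norm_nonneg _) hz)

lemma summable_U (h : Rnw f u) {z : ℂ} (hz : ‖z‖ < 1) : Summable fun n => ‖(u n : ℂ) * z ^ n‖ := by
  refine Summable.of_nonneg_of_le (fun _ => norm_nonneg _) (fun n => ?_)
    (summable_geometric_of_lt_one (norm_nonneg z) hz)
  rw [norm_mul, norm_pow, Complex.norm_real, Real.norm_of_nonneg (h.u_nonneg n)]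
  exact mul_le_of_le_one_left (by positivity) (h.u_le_one n)

lemma UF (h : Rnw f u) {z : ℂ} (hz : ‖z‖ < 1) :
    (∑' n, (u n : ℂ) * z ^ n) * (1 - ∑' n, (f n : ℂ) * z ^ n) = 1 := by
  rw [mul_sub, mul_one, tsum_mul_tsum_eq_tsum_sum_range_of_summable_norm (h.summable_U hz) (h.summable_F hz.le)]
  have hU := (h.summable_U hz).of_norm
  have e1 : ∀ n, ∑ k ∈ Finset.range (n + 1), (u k : ℂ) * z ^ k * ((f (n - k) : ℂ) * z ^ (n - k))
      = (if n = 0 then 0 else (u n : ℂ) * z ^ n) := by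
    intro n
    rcases n with _ | n
    · simp [h.f0]
    · rw [if_neg (by omega), h.u_conv n, Finset.sum_range_succ]
      simp only [Nat.sub_self, h.f0]
      push_cast
      rw [Finset.sum_mul]
      simp only [zero_mul, mul_zero, add_zero]
      refine Finset.sum_congr rfl fun k hk => ?_
      simp at hk
      have : z ^ (n + 1) = z ^ k * z ^ (n + 1 - k) := by rw [← pow_add]; congr 1; omega
      rw [this]; ring
  simp_rw [e1]
  have hs2 : Summable (fun n => if n = 0 then (0:ℂ) else (u n : ℂ) * z ^ n) := by
    refine (summable_nat_add_iff 1).1 ?_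
    simpa using (summable_nat_add_iff 1).2 hU
  rw [hU.tsum_eq_zero_add, hs2.tsum_eq_zero_add]
  simp [h.u0]

lemma F_split (h : Rnw f u) (z : ℂ) (N : ℕ) :
    (1 - z) * ∑ n ∈ Finset.range N, (rnwC f (n + 1) : ℂ) * z ^ n
      = 1 - (∑ n ∈ Finset.range (N + 1), (f n : ℂ) * z ^ n) - rnwC f (N + 1) * z ^ N := by
  induction N with
  | zero => simp [h.c_one, h.f0]
  | succ N ih =>
    rw [Finset.sum_range_succ, mul_add, ih, Finset.sum_range_succ _ (N + 1)]
    rw [h.c_succ (N + 1)]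
    push_cast
    ring

lemma F_tail (h : Rnw f u) {z : ℂ} (hz : ‖z‖ ≤ 1) (N : ℕ) :
    ‖(∑' n, (f n : ℂ) * z ^ n) - ∑ n ∈ Finset.range N, (f n : ℂ) * z ^ n‖ ≤ rnwC f N := by
  have hs := h.summable_F hz
  rw [← hs.of_norm.sum_add_tsum_nat_add N, add_sub_cancel_left]
  have hs2 := (summable_nat_add_iff N).2 hs
  refine (norm_tsum_le_tsum_norm hs2).trans ?_
  unfold rnwC
  refine hs2.tsum_le_tsum ?_ (h.summ' N)
  intro n
  rw [norm_mul, norm_pow, Complex.norm_real, Real.norm_of_nonneg (h.fpos _), add_comm]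
  exact mul_le_of_le_one_right (h.fpos _) (pow_le_one₀ (norm_nonneg _) hz)

lemma norm_one_sub_pow_le {z : ℂ} (hz : ‖z‖ ≤ 1) (n : ℕ) : ‖1 - z ^ n‖ ≤ n * ‖1 - z‖ := by
  induction n with
  | zero => simp
  | succ n ih =>
    have : 1 - z ^ (n + 1) = (1 - z ^ n) + z ^ n * (1 - z) := by ring
    rw [this]
    refine (norm_add_le _ _).trans ?_
    rw [norm_mul, norm_pow]
    have : ‖z‖ ^ n ≤ 1 := pow_le_one₀ (norm_nonneg _) hz
    push_cast
    nlinarith [norm_nonneg (1 - z)]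

lemma near_one (h : Rnw f u) (ρ : ℝ) (hρ0 : 0 ≤ ρ) (hρ : ρ ≤ 0.31) (n0 : ℕ)
    (hc : ∀ N, n0 ≤ N → N * rnwC f N ≤ ρ * rnwL f N) :
    ∃ ε : ℝ, 0 < ε ∧ ∀ z : ℂ, ‖z‖ ≤ 1 → ‖1 - z‖ < ε →
      0.01 * ‖1 - z‖ ≤ ‖1 - ∑' n, (f n : ℂ) * z ^ n‖ := by
  refine ⟨0.01 / ((n0:ℝ) ^ 2 + n0 + 1), by positivity, fun z hz hzε => ?_⟩
  set η := ‖1 - z‖ with hη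
  rcases (norm_nonneg (1 - z)).eq_or_lt with h0 | hpos
  · rw [hη, ← h0]; simp
  rw [← hη] at hpos
  have hn0 : (0:ℝ) ≤ n0 := by positivity
  have hε2 : η * ((n0:ℝ) ^ 2 + n0 + 1) < 0.01 := by rwa [lt_div_iff₀ (by positivity)] at hzε
  set N := ⌈1 / η⌉₊ with hN
  have hN1 : 1 / η ≤ N := Nat.le_ceil _
  have hN2 : (N:ℝ) < 1 / η + 1 := Nat.ceil_lt_add_one (by positivity)
  have hNη1 : 1 ≤ N * η := by rwa [div_le_iff₀ hpos] at hN1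
  have hNη2 : N * η ≤ 1 + η := by
    have := mul_lt_mul_of_pos_right hN2 hpos
    rw [add_mul, one_div_mul_cancel hpos.ne'] at this; linarith
  have hNn0 : n0 ≤ N := by
    have : (n0 : ℝ) ≤ N := by
      by_contra hcon
      push Not at hcon
      nlinarith
    exact_mod_cast this
  have hNpos : 1 ≤ N := by
    by_contra hcon
    have : N = 0 := by omega
    rw [this] at hNη1; norm_num at hNη1
  have hL1 := h.L_one_le hNpos
  set P := ∑ n ∈ Finset.range N, (rnwC f (n + 1) : ℂ) * z ^ n with hP
  have hsum : ∑ n ∈ Finset.range N, rnwC f (n + 1) * n ≤ (n0:ℝ) ^ 2 + N * (ρ * rnwL f N) := by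
    have hb : ∀ n ∈ Finset.range N, rnwC f (n+1) * n ≤ (if n < n0 then (n0:ℝ) else 0) + ρ * rnwL f N := by
      intro n hn
      simp at hn
      have hcn := h.c_nonneg (n+1)
      have hcl := h.c_le_one (n+1)
      split_ifs with hlt
      · have : (n:ℝ) ≤ n0 := by exact_mod_cast hlt.le
        have h2 : 0 ≤ ρ * rnwL f N := mul_nonneg hρ0 (by linarith)
        nlinarith [(Nat.cast_nonneg n : (0:ℝ) ≤ n)]
      · have h1 := hc (n+1) (by omega)
        have h2 : ρ * rnwL f (n+1) ≤ ρ * rnwL f N := mul_le_mul_of_nonneg_left (h.L_mono (by omega)) hρ0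
        push_cast at h1
        linarith
    refine (Finset.sum_le_sum hb).trans ?_
    rw [Finset.sum_add_distrib]
    simp only [Finset.sum_const, Finset.card_range, nsmul_eq_mul]
    gcongr
    rw [← Finset.sum_filter, Finset.sum_const, nsmul_eq_mul, sq]
    gcongr
    calc _ ≤ (Finset.range n0).card := Finset.card_le_card (by intro x; simp)
      _ = n0 := by simp
  have hP1 : rnwL f N - η * ((n0:ℝ) ^ 2 + N * (ρ * rnwL f N)) ≤ ‖P‖ := by
    have e1 : ((rnwL f N : ℝ) : ℂ) - P = ∑ n ∈ Finset.range N, (rnwC f (n + 1) : ℂ) * (1 - z ^ n) := by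
      rw [L_eq, hP]; push_cast; rw [← Finset.sum_sub_distrib]
      exact Finset.sum_congr rfl fun _ _ => by ring
    have e2 : ‖((rnwL f N : ℝ) : ℂ) - P‖ ≤ η * ((n0:ℝ) ^ 2 + N * (ρ * rnwL f N)) := by
      rw [e1]
      refine (norm_sum_le _ _).trans ?_
      refine le_trans ?_ (mul_le_mul_of_nonneg_left hsum hpos.le)
      rw [Finset.mul_sum]
      refine Finset.sum_le_sum fun n _ => ?_
      rw [norm_mul, Complex.norm_real, Real.norm_of_nonneg (h.c_nonneg _)]
      have := mul_le_mul_of_nonneg_left (norm_one_sub_pow_le hz n) (h.c_nonneg (n+1))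
      rw [← hη] at this
      linarith
    have e3 := norm_sub_norm_le ((rnwL f N : ℝ) : ℂ) P
    rw [Complex.norm_real, Real.norm_of_nonneg (h.L_nonneg _)] at e3
    linarith
  have hsplit := h.F_split z N
  rw [← hP] at hsplit
  set F := ∑' n, (f n : ℂ) * z ^ n with hF
  have htail := h.F_tail hz (N+1)
  rw [← hF] at htail
  have hc1 : η * ‖P‖ ≤ ‖1 - F‖ + 2 * rnwC f (N+1) := by
    have e : (1 - z) * P = (1 - F) + (F - ∑ n ∈ Finset.range (N + 1), (f n : ℂ) * z ^ n) - rnwC f (N + 1) * z ^ N := by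
      rw [hsplit]; ring
    have e2 : ‖(rnwC f (N + 1) : ℂ) * z ^ N‖ ≤ rnwC f (N+1) := by
      rw [norm_mul, norm_pow, Complex.norm_real, Real.norm_of_nonneg (h.c_nonneg _)]
      exact mul_le_of_le_one_right (h.c_nonneg _) (pow_le_one₀ (norm_nonneg _) hz)
    have e3 : ‖(1 - z) * P‖ ≤ ‖1 - F‖ + ‖F - ∑ n ∈ Finset.range (N + 1), (f n : ℂ) * z ^ n‖ + ‖(rnwC f (N + 1) : ℂ) * z ^ N‖ := by
      rw [e]
      exact (norm_sub_le _ _).trans (by gcongr; exact norm_add_le _ _)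
    rw [norm_mul, ← hη] at e3
    linarith
  have hcN : rnwC f (N+1) ≤ ρ * rnwL f N * η := by
    have a1 : rnwC f (N+1) ≤ rnwC f N := h.c_anti (by omega)
    have a2 := hc N hNn0
    have a3 := h.c_nonneg N
    nlinarith
  have key : η * (rnwL f N - η * ((n0:ℝ) ^ 2 + N * (ρ * rnwL f N))) ≤ ‖1 - F‖ + 2 * (ρ * rnwL f N * η) := by
    have := mul_le_mul_of_nonneg_left hP1 hpos.le
    linarith
  -- final arithmetic
  set Λ := rnwL f N
  have b1 : η * (N * (ρ * Λ)) ≤ (1 + η) * (0.31 * Λ) := by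
    have : η * (N * (ρ * Λ)) = (N * η) * (ρ * Λ) := by ring
    rw [this]
    gcongr
  have hη2 : η ≤ 0.01 := by nlinarith
  have b2 : η * (n0:ℝ)^2 ≤ 0.01 * Λ := by nlinarith
  have b3 : ρ * Λ ≤ 0.31 * Λ := by gcongr
  have b4 : 0.01 ≤ Λ - η * ((n0:ℝ) ^ 2 + N * (ρ * Λ)) - 2 * (ρ * Λ) := by nlinarith
  nlinarith

lemma F_ne_one (h : Rnw f u) (haper : ∀ d : ℕ, (∀ n, 1 ≤ n → 0 < f n → d ∣ n) → d = 1)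
    {z : ℂ} (hz : ‖z‖ ≤ 1) (hF : ∑' n, (f n : ℂ) * z ^ n = 1) : z = 1 := by
  have hs := (h.summable_F hz).of_norm
  have hre : HasSum (fun n => f n * (z ^ n).re) 1 := by
    have := Complex.reCLM.hasSum hs.hasSum
    rw [hF] at this
    simpa using this
  have hd : HasSum (fun n => f n - f n * (z ^ n).re) 0 := by
    simpa using h.fsum.sub hre
  have hnn : ∀ n, (z ^ n).re ≤ 1 := fun n =>
    (Complex.re_le_norm _).trans (by rw [norm_pow]; exact pow_le_one₀ (norm_nonneg _) hz)
  have h0 := (hasSum_zero_iff_of_nonneg (fun n => by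
    have := hnn n; have := h.fpos n; show 0 ≤ f n - f n * (z ^ n).re; nlinarith)).1 hd
  have hpow : ∀ n, 0 < f n → z ^ n = 1 := by
    intro n hn
    have h1 := congrFun h0 n
    simp only [Pi.zero_apply] at h1
    have hre1 : (z ^ n).re = 1 := by
      have : f n * (1 - (z ^ n).re) = 0 := by linarith
      rcases mul_eq_zero.1 this with h | h <;> linarith
    have hnorm : ‖z ^ n‖ ≤ 1 := by rw [norm_pow]; exact pow_le_one₀ (norm_nonneg _) hz
    have hsq := Complex.sq_norm (z ^ n)
    rw [Complex.normSq_apply, hre1] at hsq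
    apply Complex.ext
    · simp [hre1]
    · simp only [Complex.one_im]
      nlinarith [norm_nonneg (z ^ n)]
  have := haper (orderOf z) fun n _ hn => orderOf_dvd_of_pow_eq_one (hpow n hn)
  exact orderOf_eq_one_iff.1 this

lemma lower (h : Rnw f u) (haper : ∀ d : ℕ, (∀ n, 1 ≤ n → 0 < f n → d ∣ n) → d = 1)
    (ρ : ℝ) (hρ0 : 0 ≤ ρ) (hρ : ρ ≤ 0.31) (n0 : ℕ)
    (hc : ∀ N, n0 ≤ N → N * rnwC f N ≤ ρ * rnwL f N) :
    ∃ δ : ℝ, 0 < δ ∧ ∀ z : ℂ, ‖z‖ ≤ 1 →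
      δ * ‖1 - z‖ ≤ ‖1 - ∑' n, (f n : ℂ) * z ^ n‖ := by
  obtain ⟨ε, hε, hnear⟩ := h.near_one ρ hρ0 hρ n0 hc
  set K : Set ℂ := Metric.closedBall 0 1 ∩ {z | ε ≤ ‖1 - z‖} with hK
  have hKc : IsCompact K := (isCompact_closedBall 0 1).inter_right
    (isClosed_le continuous_const (by fun_prop))
  have hcont : ContinuousOn (fun z : ℂ => ‖1 - ∑' n, (f n : ℂ) * z ^ n‖) K := by
    refine (continuousOn_const.sub ?_).norm
    refine continuousOn_tsum (u := f) (fun n => by fun_prop) h.summ ?_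
    intro n z hz
    have hz1 : ‖z‖ ≤ 1 := by simpa using hz.1
    rw [norm_mul, norm_pow, Complex.norm_real, Real.norm_of_nonneg (h.fpos n)]
    exact mul_le_of_le_one_right (h.fpos n) (pow_le_one₀ (norm_nonneg _) hz1)
  obtain ⟨m, hm, hmK⟩ : ∃ m : ℝ, 0 < m ∧ ∀ z ∈ K, m ≤ ‖1 - ∑' n, (f n : ℂ) * z ^ n‖ := by
    rcases K.eq_empty_or_nonempty with he | hne
    · exact ⟨1, one_pos, by simp [he]⟩
    · obtain ⟨z0, hz0, hmin⟩ := hKc.exists_isMinOn hne hcont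
      refine ⟨_, ?_, fun z hz => hmin hz⟩
      have hz1 : ‖z0‖ ≤ 1 := by simpa using hz0.1
      rw [norm_pos_iff, sub_ne_zero]
      intro heq
      have := h.F_ne_one haper hz1 heq.symm
      have h2 : ε ≤ ‖1 - z0‖ := hz0.2
      rw [this] at h2; simp at h2; linarith
  refine ⟨min 0.01 (m / 2), lt_min (by norm_num) (by positivity), fun z hz => ?_⟩
  by_cases hzε : ‖1 - z‖ < ε
  · exact le_trans (by gcongr; exact min_le_left _ _) (hnear z hz hzε)
  · push Not at hzε
    have h1 := hmK z ⟨by simpa using hz, hzε⟩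
    have h2 : ‖1 - z‖ ≤ 2 := (norm_sub_le _ _).trans (by simp; linarith)
    calc _ ≤ (m / 2) * 2 := by gcongr; exact min_le_right _ _
      _ = m := by ring
      _ ≤ _ := h1

lemma sq_bound (h : Rnw f u) (haper : ∀ d : ℕ, (∀ n, 1 ≤ n → 0 < f n → d ∣ n) → d = 1)
    (ρ : ℝ) (hρ0 : 0 ≤ ρ) (hρ : ρ ≤ 0.31) (n0 : ℕ)
    (hc : ∀ N, n0 ≤ N → N * rnwC f N ≤ ρ * rnwL f N) :
    ∃ B : ℝ, 0 ≤ B ∧ ∀ n, ∑ k ∈ Finset.range n, (u k - u (k + 1)) ^ 2 ≤ B ^ 2 := by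
  obtain ⟨δ, hδ, hlow⟩ := h.lower haper ρ hρ0 hρ n0 hc
  refine ⟨1 / δ, by positivity, fun n => ?_⟩
  -- coefficients of (1 - z) U
  let d : ℕ → ℝ := fun k => if k = 0 then 1 else u k - u (k - 1)
  have hD : ∀ z : ℂ, ‖z‖ < 1 → HasSum (fun k => (d k : ℂ) * z ^ k) ((1 - z) * ∑' n, (u n : ℂ) * z ^ n) := by
    intro z hz
    have hU := (h.summable_U hz).of_norm.hasSum
    have h2 : HasSum (fun k : ℕ => if k = 0 then (0:ℂ) else (u (k-1) : ℂ) * z ^ k) (z * ∑' n, (u n : ℂ) * z ^ n) := by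
      rw [← hasSum_nat_add_iff' 1]
      simp only [Finset.sum_range_one, if_true, sub_zero]
      refine rnw_hasSum_congr (hU.mul_left z) fun k => ?_
      simp; ring
    rw [sub_mul, one_mul]
    refine rnw_hasSum_congr (hU.sub h2) fun k => ?_
    by_cases hk : k = 0
    · simp [hk, d, h.u0]
    · simp [hk, d]; ring
  have hbd : ∀ z : ℂ, ‖z‖ < 1 → ‖∑' k, (d k : ℂ) * z ^ k‖ ≤ 1 / δ := by
    intro z hz
    rw [(hD z hz).tsum_eq, norm_mul]
    have h1 := congrArg norm (h.UF hz)
    rw [norm_mul, norm_one] at h1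
    have h2 := hlow z hz.le
    rw [le_div_iff₀ hδ]
    nlinarith [norm_nonneg (∑' n, (u n : ℂ) * z ^ n)]
  have hdle : ∀ k, |d k| ≤ 1 := by
    intro k
    by_cases hk : k = 0
    · simp [d, hk]
    · simp only [d, hk, if_false, abs_le]
      constructor <;> linarith [h.u_nonneg k, h.u_nonneg (k-1), h.u_le_one k, h.u_le_one (k-1)]
  have hr : ∀ r : ℝ, r ∈ Set.Ico (0:ℝ) 1 → ∑ k ∈ Finset.range (n + 1), (d k * r ^ k) ^ 2 ≤ (1 / δ) ^ 2 := by
    intro r ⟨hr0, hr1⟩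
    have := rnw_bessel_s13 (fun k => ((d k * r ^ k : ℝ) : ℂ)) ?_ (1 / δ) (by positivity) ?_ (n + 1)
    · simpa only [Complex.norm_real, Real.norm_eq_abs, sq_abs] using this
    · refine Summable.of_nonneg_of_le (fun _ => norm_nonneg _) (fun k => ?_)
        (summable_geometric_of_lt_one hr0 hr1)
      rw [Complex.norm_real, Real.norm_eq_abs, abs_mul, abs_of_nonneg (by positivity : 0 ≤ r ^ k)]
      exact mul_le_of_le_one_left (by positivity) (hdle k)
    · intro z hz
      have := hbd (r * z) (by simp [hz, abs_of_nonneg hr0, hr1])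
      refine le_of_eq_of_le ?_ this
      congr 1; refine tsum_congr fun k => ?_
      push_cast; ring
  have hlim : ∑ k ∈ Finset.range (n + 1), (d k) ^ 2 ≤ (1 / δ) ^ 2 := by
    have ht : Tendsto (fun r : ℝ => ∑ k ∈ Finset.range (n + 1), (d k * r ^ k) ^ 2) (nhdsWithin 1 (Set.Iio 1))
        (nhds (∑ k ∈ Finset.range (n + 1), (d k * 1 ^ k) ^ 2)) := by
      refine Tendsto.mono_left ?_ nhdsWithin_le_nhds
      exact Continuous.tendsto (by fun_prop) 1
    simp only [one_pow, mul_one] at ht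
    refine le_of_tendsto ht ?_
    filter_upwards [Ico_mem_nhdsLT (show (0:ℝ) < 1 by norm_num)] with r hr'
    exact hr r hr'
  refine le_trans ?_ hlim
  rw [Finset.sum_range_succ']
  refine le_trans (le_of_eq ?_) (le_add_of_nonneg_right (sq_nonneg _))
  refine Finset.sum_congr rfl fun k _ => ?_
  simp [d]; ring

lemma L_growth (h : Rnw f u) (ρ : ℝ) (hρ0 : 0 ≤ ρ) (hρ : ρ ≤ 0.31) (n0 : ℕ)
    (hc : ∀ N, n0 ≤ N → N * rnwC f N ≤ ρ * rnwL f N) :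
    ∃ K : ℝ, 0 < K ∧ ∀ N, n0 + 1 ≤ N → rnwL f N ≤ K * (N:ℝ) ^ (0.4 : ℝ) := by
  refine ⟨rnwL f (n0 + 1) / ((n0 + 1 : ℕ) : ℝ) ^ (0.4:ℝ), ?_, ?_⟩
  · have := h.L_one_le (N := n0 + 1) (by omega)
    positivity
  · intro N hN
    induction N, hN using Nat.le_induction with
    | base =>
      rw [div_mul_cancel₀]; positivity
    | succ N hN ih =>
      set K := rnwL f (n0 + 1) / ((n0 + 1 : ℕ) : ℝ) ^ (0.4:ℝ)
      have hc' := hc (N+1) (by omega)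
      have hL := L_succ f N
      have hL1 := h.L_one_le (N := N+1) (by omega)
      have hMpos : (0:ℝ) < ((N+1 : ℕ) : ℝ) := by positivity
      set M : ℝ := ((N+1 : ℕ) : ℝ) with hM
      have hMN : (N:ℝ) = M * (1 + (-(1 / M))) := by
        rw [mul_add, mul_neg, mul_one_div_cancel hMpos.ne', hM]; push_cast; ring
      have hM1 : 1 / M ≤ 1 := by
        rw [div_le_one hMpos, hM]; push_cast; linarith [(Nat.cast_nonneg N : (0:ℝ) ≤ N)]
      have hb : (1 + (-(1 / M))) ^ (0.4:ℝ) ≤ 1 + 0.4 * (-(1 / M)) :=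
        rpow_one_add_le_one_add_mul_self (by linarith) (by norm_num) (by norm_num)
      have hN0 : (0:ℝ) ≤ 1 + (-(1 / M)) := by linarith
      rw [hMN, Real.mul_rpow hMpos.le hN0] at ih
      have hNp : 0 < (1 + (-(1 / M))) ^ (0.4:ℝ) := by
        apply Real.rpow_pos_of_pos
        have : (0:ℝ) < N := by exact_mod_cast (by omega : 0 < N)
        rw [hMN] at this
        exact pos_of_mul_pos_right this hMpos.le
      have hcc : rnwC f (N+1) ≤ 0.4 * (1 / M) * rnwL f (N+1) := by
        rw [mul_one_div, div_mul_eq_mul_div, le_div_iff₀ hMpos]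
        nlinarith
      have h3 : rnwL f (N+1) * (1 + (-(1 / M))) ^ (0.4:ℝ) ≤ rnwL f N := by
        calc _ ≤ rnwL f (N+1) * (1 + 0.4 * (-(1 / M))) := by gcongr
          _ ≤ rnwL f N := by linarith
      have h4 : rnwL f (N+1) * (1 + (-(1 / M))) ^ (0.4:ℝ) ≤ K * M ^ (0.4:ℝ) * (1 + (-(1 / M))) ^ (0.4:ℝ) := by
        linarith
      exact le_of_mul_le_mul_right h4 hNp

lemma smooth (h : Rnw f u) (haper : ∀ d : ℕ, (∀ n, 1 ≤ n → 0 < f n → d ∣ n) → d = 1)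
    (ρ : ℝ) (hρ0 : 0 ≤ ρ) (hρ : ρ ≤ 0.31) (n0 : ℕ)
    (hc : ∀ N, n0 ≤ N → N * rnwC f N ≤ ρ * rnwL f N)
    (hA : Tendsto (rnwA u) atTop atTop) :
    (fun n : ℕ => ∑ k ∈ Finset.Icc 1 n, |u k - u (k + 1)|)
        =o[Filter.atTop] (fun n : ℕ => rnwA u n) := by
  obtain ⟨B, hB, hsq⟩ := h.sq_bound haper ρ hρ0 hρ n0 hc
  obtain ⟨K, hK, hL⟩ := h.L_growth ρ hρ0 hρ n0 hc
  have h1 : ∀ n : ℕ, ∑ k ∈ Finset.Icc 1 n, |u k - u (k + 1)| ≤ B * (n:ℝ) ^ (0.5:ℝ) := by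
    intro n
    have hcs := sq_sum_le_card_mul_sum_sq (s := Finset.Icc 1 n) (f := fun k => |u k - u (k + 1)|)
    simp only [Nat.card_Icc, add_tsub_cancel_right, sq_abs] at hcs
    have h2 : ∑ k ∈ Finset.Icc 1 n, (u k - u (k + 1)) ^ 2 ≤ B ^ 2 := by
      refine le_trans ?_ (hsq (n + 1))
      refine Finset.sum_le_sum_of_subset_of_nonneg ?_ fun _ _ _ => sq_nonneg _
      intro x hx; simp at hx ⊢; omega
    have h3 : (B * (n:ℝ) ^ (0.5:ℝ)) ^ 2 = n * B ^ 2 := by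
      rw [mul_pow, ← Real.rpow_natCast, ← Real.rpow_natCast, ← Real.rpow_mul (by positivity)]
      norm_num; ring
    refine le_of_sq_le_sq ?_ (by positivity)
    rw [h3]
    exact hcs.trans (by gcongr)
  have h2 : ∀ᶠ n : ℕ in atTop, (n:ℝ) ^ (0.6:ℝ) ≤ 2 * K * rnwA u n := by
    filter_upwards [eventually_ge_atTop (n0 + 1), hA.eventually_ge_atTop 1] with n hn hAn
    have h3 := h.SL_ge' n
    have h4 := hL n hn
    have hn' : (0:ℝ) < n := by exact_mod_cast (by omega : 0 < n)
    have hp : 0 < (n:ℝ) ^ (0.4:ℝ) := by positivity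
    have e : (n:ℝ) = (n:ℝ) ^ (0.6:ℝ) * (n:ℝ) ^ (0.4:ℝ) := by
      rw [← Real.rpow_add hn']; norm_num
    have hS : rnwS u n ≤ 2 * rnwA u n := by rw [h.S_eq]; linarith
    have h5 : (n:ℝ) ^ (0.6:ℝ) * (n:ℝ) ^ (0.4:ℝ) ≤ (2 * K * rnwA u n) * (n:ℝ) ^ (0.4:ℝ) := by
      rw [← e]
      calc (n:ℝ) ≤ rnwS u n * rnwL f n := h3
        _ ≤ (2 * rnwA u n) * (K * (n:ℝ) ^ (0.4 : ℝ)) := by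
          gcongr
          exact h.L_nonneg _
        _ = _ := by ring
    exact le_of_mul_le_mul_right h5 hp
  have o1 : (fun n : ℕ => (n:ℝ) ^ (0.5:ℝ)) =o[atTop] (fun n : ℕ => (n:ℝ) ^ (0.6:ℝ)) :=
    by
    rw [Asymptotics.isLittleO_iff_tendsto']
    · have := (tendsto_rpow_neg_atTop (show (0:ℝ) < 0.1 by norm_num)).comp
        (tendsto_natCast_atTop_atTop (R := ℝ))
      refine this.congr' ?_
      filter_upwards [eventually_ge_atTop 1] with n hn
      have hn' : (0:ℝ) < n := by exact_mod_cast hn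
      rw [← Real.rpow_sub hn']; norm_num
    · filter_upwards [eventually_ge_atTop 1] with n hn h0
      have hn' : (0:ℝ) < n := by exact_mod_cast hn
      have : 0 < (n:ℝ) ^ (0.6:ℝ) := by positivity
      linarith
  have O1 : (fun n : ℕ => ∑ k ∈ Finset.Icc 1 n, |u k - u (k + 1)|) =O[atTop] (fun n : ℕ => (n:ℝ) ^ (0.5:ℝ)) := by
    refine Asymptotics.IsBigO.of_bound B (Eventually.of_forall fun n => ?_)
    rw [Real.norm_of_nonneg (Finset.sum_nonneg fun _ _ => abs_nonneg _), Real.norm_of_nonneg (by positivity)]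
    exact h1 n
  have O2 : (fun n : ℕ => (n:ℝ) ^ (0.6:ℝ)) =O[atTop] (fun n : ℕ => rnwA u n) := by
    refine Asymptotics.IsBigO.of_bound (2 * K) ?_
    filter_upwards [h2, hA.eventually_ge_atTop 1] with n hn hAn
    rw [Real.norm_of_nonneg (by positivity), Real.norm_of_nonneg (by linarith)]
    exact hn
  exact (O1.trans_isLittleO o1).trans_isBigO O2

end Rnw

lemma rnw_karamata (c : ℕ → ℝ) (hc : Antitone c) (hc0 : ∀ n, 0 ≤ c n) (w : ℕ → ℝ) (hw : ∀ N, 0 ≤ w N)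
    (m : ℕ → ℝ) (hm : ∀ k : ℕ, 1 ≤ k →
      Tendsto (fun N : ℕ => w N * ∑' n : ℕ, c n * (Real.exp (-(1 / (N:ℝ))) ^ n) ^ k) atTop (nhds (m k))) :
    ∃ κ, Tendsto (fun N : ℕ => w N * ∑ n ∈ Finset.range N, c n) atTop (nhds κ) := by
  set v : ℕ → ℕ → ℝ := fun N n => Real.exp (-(1 / (N:ℝ))) ^ n with hv
  have hv' : ∀ N n, v N n = Real.exp (-((n:ℝ) / N)) := by
    intro N n
    simp only [hv]
    rw [← Real.exp_nat_mul]; congr 1; ring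
  have hv0 : ∀ N n, 0 < v N n := fun N n => by rw [hv']; exact Real.exp_pos _
  have hv1 : ∀ N n, v N n ≤ 1 := fun N n => by
    rw [hv', Real.exp_le_one_iff]
    have : (0:ℝ) ≤ (n:ℝ) / N := by positivity
    linarith
  have hsv : ∀ N : ℕ, 1 ≤ N → ∀ k : ℕ, 1 ≤ k → Summable (fun n => c n * v N n ^ k) := by
    intro N hN k hk
    have hr1 : Real.exp (-(1 / (N:ℝ))) < 1 := by
      rw [Real.exp_lt_one_iff]
      have : (0:ℝ) < 1 / N := by have : (0:ℝ) < N := by exact_mod_cast hN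
                                 positivity
      linarith
    refine Summable.of_nonneg_of_le (fun n => mul_nonneg (hc0 n) (pow_nonneg (hv0 N n).le k)) (fun n => ?_)
      ((summable_geometric_of_lt_one (Real.exp_pos _).le hr1).mul_left (c 0))
    have h1 : c n ≤ c 0 := hc (Nat.zero_le _)
    have h2 : v N n ^ k ≤ v N n := pow_le_of_le_one (hv0 N n).le (hv1 N n) (by omega)
    calc c n * v N n ^ k ≤ c 0 * v N n := by
          gcongr
          exact hc0 0
      _ = _ := rfl
  have hpoly : ∀ p : Polynomial ℝ,
      (∀ N : ℕ, 1 ≤ N → Summable (fun n => c n * (v N n * p.eval (v N n)))) ∧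
      ∃ l, Tendsto (fun N : ℕ => w N * ∑' n, c n * (v N n * p.eval (v N n))) atTop (nhds l) := by
    intro p
    induction p using Polynomial.induction_on' with
    | add p q hp hq =>
      obtain ⟨hps, lp, hpl⟩ := hp
      obtain ⟨hqs, lq, hql⟩ := hq
      have e : ∀ N n, c n * (v N n * (p + q).eval (v N n)) =
          c n * (v N n * p.eval (v N n)) + c n * (v N n * q.eval (v N n)) := by
        intro N n; rw [Polynomial.eval_add]; ring
      simp_rw [e]
      refine ⟨fun N hN => (hps N hN).add (hqs N hN), lp + lq, ?_⟩
      refine (hpl.add hql).congr' ?_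
      filter_upwards [eventually_ge_atTop 1] with N hN
      rw [(hps N hN).tsum_add (hqs N hN)]; ring
    | monomial k a =>
      have e : ∀ N n, c n * (v N n * (Polynomial.monomial k a).eval (v N n)) =
          a * (c n * v N n ^ (k+1)) := by
        intro N n; rw [Polynomial.eval_monomial]; ring
      simp_rw [e]
      refine ⟨fun N hN => (hsv N hN (k+1) (by omega)).mul_left a, a * m (k+1), ?_⟩
      refine ((hm (k+1) (by omega)).const_mul a).congr fun N => ?_
      rw [tsum_mul_left]; ring
  -- uniform bound
  obtain ⟨K, hK0, hK⟩ : ∃ K : ℝ, 0 < K ∧ ∀ᶠ N : ℕ in atTop, w N * ∑' n, c n * v N n ≤ K := by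
    refine ⟨|m 1| + 1, by positivity, ?_⟩
    have := hm 1 le_rfl
    simp only [pow_one] at this
    filter_upwards [this.eventually_le_const (show m 1 < |m 1| + 1 by linarith [le_abs_self (m 1)])] with N hN
    exact hN
  have hest : ∀ ε : ℝ, 0 < ε → ∃ p : Polynomial ℝ, ∀ᶠ N : ℕ in atTop,
      |w N * ∑ n ∈ Finset.range N, c n - w N * ∑' n, c n * (v N n * p.eval (v N n))| ≤ 7 * K * ε := by
    intro ε hε
    set a1 := Real.exp (-(1 + ε)) with ha1
    set a0 := Real.exp (-1) with ha0
    have ha1p : 0 < a1 := Real.exp_pos _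
    have ha10 : a1 < a0 := Real.exp_lt_exp.2 (by linarith)
    let g : ℝ → ℝ := fun x => min 1 (max 0 ((x - a1) / (a0 - a1))) / max x a1
    have hg : Continuous g := by
      refine Continuous.div (by fun_prop) (by fun_prop) fun x => ?_
      exact (lt_of_lt_of_le ha1p (le_max_right _ _)).ne'
    obtain ⟨p, hp⟩ := exists_polynomial_near_of_continuousOn 0 1 g hg.continuousOn ε hε
    refine ⟨p, ?_⟩
    filter_upwards [hK, eventually_ge_atTop 1, eventually_ge_atTop ⌈1 / ε⌉₊] with N hKN hN1 hNε
    have hNp : (0:ℝ) < N := by exact_mod_cast hN1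
    have hNε' : 1 ≤ ε * N := by
      have : 1 / ε ≤ N := (Nat.le_ceil _).trans (by exact_mod_cast hNε)
      rw [div_le_iff₀ hε] at this; linarith
    set M := ⌈(1 + ε) * N⌉₊ with hM
    have hM2 : (M:ℝ) < (1 + ε) * N + 1 := Nat.ceil_lt_add_one (by positivity)
    have hNM : N ≤ M := by
      have : (N:ℝ) ≤ M := le_trans (by nlinarith) (Nat.le_ceil _)
      exact_mod_cast this
    -- pointwise estimate
    have hpt : ∀ n, |(if n < N then (1:ℝ) else 0) - v N n * p.eval (v N n)| ≤
        ε * v N n + (if n ∈ Finset.Ico N M then (1:ℝ) else 0) := by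
      intro n
      have hvn := hv0 N n
      have hpg := hp (v N n) ⟨hvn.le, hv1 N n⟩
      have hpg2 : |v N n * g (v N n) - v N n * p.eval (v N n)| ≤ ε * v N n := by
        rw [← mul_sub, abs_mul, abs_of_pos hvn, abs_sub_comm, mul_comm]
        gcongr
      have hmain : |(if n < N then (1:ℝ) else 0) - v N n * g (v N n)| ≤
          (if n ∈ Finset.Ico N M then (1:ℝ) else 0) := by
        by_cases h1 : n < N
        · have hlt : a0 ≤ v N n := by
            rw [hv', ha0, Real.exp_le_exp]
            have : (n:ℝ) / N ≤ 1 := by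
              rw [div_le_one hNp]; exact_mod_cast h1.le
            linarith
          have e1 : (1:ℝ) ≤ (v N n - a1) / (a0 - a1) := by
            rw [le_div_iff₀ (by linarith)]; linarith
          have e2 : g (v N n) = 1 / v N n := by
            simp only [g]
            rw [max_eq_left (by linarith : a1 ≤ v N n), max_eq_right (by linarith), min_eq_left e1]
          rw [e2, mul_one_div_cancel hvn.ne']
          simp [h1, not_le.2 h1]
        · by_cases h2 : n < M
          · have : n ∈ Finset.Ico N M := by simp; omega
            rw [if_neg h1, if_pos this, zero_sub, abs_neg]
            simp only [g]
            have b0 : (0:ℝ) ≤ min 1 (max 0 ((v N n - a1) / (a0 - a1))) := le_min zero_le_one (le_max_left _ _)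
            have b1 : min 1 (max 0 ((v N n - a1) / (a0 - a1))) ≤ 1 := min_le_left _ _
            have b2 : v N n ≤ max (v N n) a1 := le_max_left _ _
            have b3 : 0 < max (v N n) a1 := lt_of_lt_of_le hvn b2
            rw [abs_of_nonneg (by positivity), ← mul_div_assoc, div_le_one b3]
            nlinarith
          · have : n ∉ Finset.Ico N M := by simp; omega
            rw [if_neg h1, if_neg this]
            have hle : v N n ≤ a1 := by
              rw [hv', ha1, Real.exp_le_exp]
              have h3 : (1 + ε) * N ≤ n := (Nat.le_ceil _).trans (by exact_mod_cast (not_lt.1 h2))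
              have : 1 + ε ≤ (n:ℝ) / N := by rwa [le_div_iff₀ hNp]
              linarith
            have e1 : (v N n - a1) / (a0 - a1) ≤ 0 :=
              div_nonpos_of_nonpos_of_nonneg (by linarith) (by linarith)
            have : g (v N n) = 0 := by
              simp only [g]
              rw [max_eq_left e1]; simp
            rw [this]; simp
      calc _ ≤ |(if n < N then (1:ℝ) else 0) - v N n * g (v N n)| +
            |v N n * g (v N n) - v N n * p.eval (v N n)| := abs_sub_le _ _ _
        _ ≤ _ := by linarith
    -- sums
    have hs1 : HasSum (fun n => c n * (if n < N then (1:ℝ) else 0)) (∑ n ∈ Finset.range N, c n) := by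
      have : ∑ n ∈ Finset.range N, c n = ∑ n ∈ Finset.range N, c n * (if n < N then (1:ℝ) else 0) :=
        Finset.sum_congr rfl fun n hn => by simp at hn; simp [hn]
      rw [this]
      exact hasSum_sum_of_ne_finset_zero fun n hn => by simp at hn; simp [hn]
    have hs2 : HasSum (fun n => c n * (if n ∈ Finset.Ico N M then (1:ℝ) else 0)) (∑ n ∈ Finset.Ico N M, c n) := by
      have : ∑ n ∈ Finset.Ico N M, c n = ∑ n ∈ Finset.Ico N M, c n * (if n ∈ Finset.Ico N M then (1:ℝ) else 0) :=
        Finset.sum_congr rfl fun n hn => by rw [if_pos hn, mul_one]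
      rw [this]
      exact hasSum_sum_of_ne_finset_zero fun n hn => by rw [if_neg hn, mul_zero]
    have hs3 := ((hpoly p).1 N hN1).hasSum
    have hs4 : Summable (fun n => c n * v N n) := by simpa using hsv N hN1 1 le_rfl
    have hs5 := (hs4.hasSum.mul_left ε).add hs2
    set V := ∑' n, c n * v N n with hV
    have hV0 : 0 ≤ V := tsum_nonneg fun n => mul_nonneg (hc0 n) (hv0 N n).le
    have hdiff : |∑ n ∈ Finset.range N, c n - ∑' n, c n * (v N n * p.eval (v N n))| ≤
        ε * V + ∑ n ∈ Finset.Ico N M, c n := by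
      have hd := hs1.sub hs3
      rw [abs_le]
      constructor
      · refine hasSum_le (fun n => ?_) hs5.neg hd
        have := mul_le_mul_of_nonneg_left (abs_le.1 (hpt n)).1 (hc0 n)
        linarith
      · refine hasSum_le (fun n => ?_) hd hs5
        have := mul_le_mul_of_nonneg_left (abs_le.1 (hpt n)).2 (hc0 n)
        linarith
    have hLN : ∑ n ∈ Finset.range N, c n ≤ 3 * V := by
      calc ∑ n ∈ Finset.range N, c n ≤ ∑ n ∈ Finset.range N, 3 * (c n * v N n) := by
            refine Finset.sum_le_sum fun n hn => ?_
            simp at hn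
            have hlt : a0 ≤ v N n := by
              rw [hv', ha0, Real.exp_le_exp]
              have : (n:ℝ) / N ≤ 1 := by
                rw [div_le_one hNp]; exact_mod_cast hn.le
              linarith
            have h3 : (1:ℝ) ≤ 3 * a0 := by
              rw [ha0, Real.exp_neg]
              have := Real.exp_one_lt_d9
              have h4 := Real.exp_pos 1
              rw [← div_eq_mul_inv, le_div_iff₀ h4]; linarith
            have := mul_le_mul_of_nonneg_left (show (1:ℝ) ≤ 3 * v N n by linarith) (hc0 n)
            linarith
        _ = 3 * ∑ n ∈ Finset.range N, c n * v N n := by rw [Finset.mul_sum]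
        _ ≤ 3 * V := by
            gcongr
            exact hs4.sum_le_tsum _ fun n _ => mul_nonneg (hc0 n) (hv0 N n).le
    have hcN : N * c N ≤ ∑ n ∈ Finset.range N, c n := by
      have : ∑ n ∈ Finset.range N, c N ≤ ∑ n ∈ Finset.range N, c n :=
        Finset.sum_le_sum fun n hn => hc (by simp at hn; omega)
      simpa using this
    have hIco : ∑ n ∈ Finset.Ico N M, c n ≤ 6 * ε * V := by
      have h1 : ∑ n ∈ Finset.Ico N M, c n ≤ (M - N : ℝ) * c N := by
        have : ∑ n ∈ Finset.Ico N M, c n ≤ ∑ n ∈ Finset.Ico N M, c N :=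
          Finset.sum_le_sum fun n hn => hc (by simp at hn; omega)
        simpa [Nat.cast_sub hNM] using this
      have h2 : (M - N : ℝ) * c N ≤ (2 * ε * N) * c N := by
        refine mul_le_mul_of_nonneg_right ?_ (hc0 N); nlinarith
      nlinarith
    rw [← mul_sub, abs_mul, abs_of_nonneg (hw N)]
    calc _ ≤ w N * (ε * V + 6 * ε * V) := by
          refine mul_le_mul_of_nonneg_left ?_ (hw N); linarith
      _ = 7 * ε * (w N * V) := by ring
      _ ≤ 7 * ε * K := by gcongr
      _ = _ := by ring
  -- Cauchy
  refine cauchySeq_tendsto_of_complete ?_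
  rw [Metric.cauchySeq_iff']
  intro ε hε
  obtain ⟨p, hp⟩ := hest (ε / (28 * K)) (by positivity)
  have h7 : 7 * K * (ε / (28 * K)) = ε / 4 := by field_simp; norm_num
  rw [h7] at hp
  obtain ⟨l, hl⟩ := (hpoly p).2
  have hl' := (Metric.tendsto_nhds.1 hl) (ε / 8) (by positivity)
  obtain ⟨N0, hN0⟩ := eventually_atTop.1 (hp.and hl')
  refine ⟨N0, fun n hn => ?_⟩
  obtain ⟨a1, a2⟩ := hN0 n hn
  obtain ⟨b1, b2⟩ := hN0 N0 le_rfl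
  rw [Real.dist_eq, abs_lt] at a2 b2 ⊢
  rw [abs_le] at a1 b1
  constructor <;> linarith [a1.1, a1.2, b1.1, b1.2, a2.1, a2.2, b2.1, b2.2]


namespace Rnw
variable {f u : ℕ → ℝ}

lemma U_integral (h : Rnw f u) {x : ℝ} (hx : 0 < x) :
    ∑' k : ℕ, u k * Real.exp (-(k * x)) = ∫ y in Set.Ici (0:ℝ), rnwS u ⌊y / x⌋₊ * Real.exp (-y) := by
  set F : ℕ → ℝ → ℝ := fun k => (Set.Ici ((k:ℝ) * x)).indicator (fun y => u k * Real.exp (-y)) with hF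
  have hsub : ∀ k : ℕ, Set.Ici ((k:ℝ) * x) ⊆ Set.Ici 0 := fun k y hy => by
    have : 0 ≤ (k:ℝ) * x := by positivity
    exact le_trans this hy
  have hint : ∀ k : ℕ, MeasureTheory.IntegrableOn (fun y => u k * Real.exp (-y)) (Set.Ici ((k:ℝ) * x)) := by
    intro k
    rw [integrableOn_Ici_iff_integrableOn_Ioi]
    have := exp_neg_integrableOn_Ioi ((k:ℝ) * x) one_pos
    simp only [neg_mul, one_mul] at this
    exact this.const_mul (u k)
  have hFi : ∀ k, MeasureTheory.Integrable (F k) (MeasureTheory.volume.restrict (Set.Ici 0)) := by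
    intro k
    rw [hF]
    exact ((MeasureTheory.integrable_indicator_iff measurableSet_Ici).2 (hint k)).integrableOn
  have hFint : ∀ k, ∫ y in Set.Ici (0:ℝ), F k y = u k * Real.exp (-(k * x)) := by
    intro k
    rw [hF]
    rw [MeasureTheory.setIntegral_indicator measurableSet_Ici, Set.inter_eq_right.2 (hsub k),
      MeasureTheory.integral_Ici_eq_integral_Ioi, MeasureTheory.integral_const_mul, integral_exp_neg_Ioi]
  have hFnn : ∀ k y, 0 ≤ F k y := by
    intro k y
    exact Set.indicator_nonneg (fun y _ => mul_nonneg (h.u_nonneg k) (Real.exp_pos _).le) y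
  have hsumm : Summable (fun k : ℕ => u k * Real.exp (-(k * x))) := by
    have hr1 : Real.exp (-x) < 1 := by rw [Real.exp_lt_one_iff]; linarith
    refine Summable.of_nonneg_of_le (fun n => mul_nonneg (h.u_nonneg n) (Real.exp_pos _).le) (fun n => ?_)
      (summable_geometric_of_lt_one (Real.exp_pos _).le hr1)
    rw [← Real.exp_nat_mul]
    have : (n:ℝ) * -x = -(n * x) := by ring
    rw [this]
    exact mul_le_of_le_one_left (Real.exp_pos _).le (h.u_le_one n)
  have hs := MeasureTheory.hasSum_integral_of_summable_integral_norm hFi (by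
    have : ∀ k, ∫ y in Set.Ici (0:ℝ), ‖F k y‖ = u k * Real.exp (-(k * x)) := by
      intro k
      rw [← hFint k]
      congr 1; ext y; exact Real.norm_of_nonneg (hFnn k y)
    simp_rw [this]; exact hsumm)
  simp_rw [hFint] at hs
  rw [hs.tsum_eq]
  refine MeasureTheory.setIntegral_congr_fun measurableSet_Ici fun y hy => ?_
  have hy0 : (0:ℝ) ≤ y := hy
  rw [tsum_eq_sum (s := Finset.range (⌊y / x⌋₊ + 1)), rnwS, Finset.sum_mul]
  · refine Finset.sum_congr rfl fun k hk => ?_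
    have hk' : k ≤ ⌊y / x⌋₊ := by simp at hk; omega
    have : (k:ℝ) * x ≤ y := by
      rw [← le_div_iff₀ hx]; exact (Nat.le_floor_iff (by positivity)).1 hk'
    rw [hF]; simp only
    rw [Set.indicator_of_mem (by exact this)]
  · intro k hk
    have hk' : ⌊y / x⌋₊ < k := by simp at hk; omega
    have : y < (k:ℝ) * x := by
      rw [← div_lt_iff₀ hx]; exact (Nat.floor_lt (by positivity)).1 hk'
    rw [hF]; simp only
    rw [Set.indicator_of_notMem (by simpa using this)]

lemma abel (h : Rnw f u) (t : ℝ)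
    (hS : ∀ l : ℝ, 0 < l → Tendsto (fun n : ℕ => rnwS u ⌊l * (n : ℝ)⌋₊ / rnwS u n) atTop (nhds (l ^ t)))
    (k : ℕ) (hk : 1 ≤ k) :
    Tendsto (fun N : ℕ => (∑' n : ℕ, u n * (Real.exp (-(1 / (N:ℝ))) ^ n) ^ k) / rnwS u N) atTop
      (nhds (∫ y in Set.Ici (0:ℝ), (y / k) ^ t * Real.exp (-y))) := by
  have hkp : (0:ℝ) < k := by exact_mod_cast hk
  have hk1 : (1:ℝ) ≤ k := by exact_mod_cast hk
  have key : Tendsto (fun N : ℕ => ∫ y in Set.Ici (0:ℝ), rnwS u ⌊y / k * N⌋₊ / rnwS u N * Real.exp (-y)) atTop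
      (nhds (∫ y in Set.Ici (0:ℝ), (y / k) ^ t * Real.exp (-y))) := by
    refine MeasureTheory.tendsto_integral_of_dominated_convergence (fun y => 4 * Real.exp (-(1/2) * y)) ?_ ?_ ?_ ?_
    · intro N
      refine Measurable.aestronglyMeasurable ?_
      refine Measurable.mul ?_ (by fun_prop)
      refine Measurable.div_const ?_ _
      exact (measurable_from_top (f := rnwS u)).comp (Nat.measurable_floor.comp (by fun_prop))
    · have := exp_neg_integrableOn_Ioi (0:ℝ) (show (0:ℝ) < 1/2 by norm_num)
      have h3 : MeasureTheory.IntegrableOn (fun y => Real.exp (-(1/2) * y)) (Set.Ici (0:ℝ)) := by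
        rw [integrableOn_Ici_iff_integrableOn_Ioi]; exact this
      exact h3.const_mul 4
    · intro N
      filter_upwards [MeasureTheory.ae_restrict_mem measurableSet_Ici] with y hy
      have hy0 : (0:ℝ) ≤ y := hy
      have hSN : 0 < rnwS u N := by linarith [h.S_one_le N]
      have hSm := h.S_one_le ⌊y / k * N⌋₊
      rw [Real.norm_of_nonneg (by positivity)]
      have hyk : y / k ≤ y := div_le_self hy0 hk1
      have h1 : rnwS u ⌊y / k * N⌋₊ / rnwS u N ≤ 4 * Real.exp (y / 2) := by
        rw [div_le_iff₀ hSN]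
        refine (h.S_potter N (y / k) (by positivity)).trans ?_
        gcongr
        have := Real.add_one_le_exp (y / 2)
        linarith
      calc _ ≤ 4 * Real.exp (y / 2) * Real.exp (-y) := by gcongr
        _ = _ := by rw [mul_assoc, ← Real.exp_add]; congr 2; ring
    · have hne : ∀ᵐ y ∂(MeasureTheory.volume.restrict (Set.Ici (0:ℝ))), y ≠ 0 :=
        MeasureTheory.ae_restrict_of_ae (MeasureTheory.Measure.ae_ne _ 0)
      filter_upwards [MeasureTheory.ae_restrict_mem measurableSet_Ici, hne] with y hy hy1
      have hy0 : (0:ℝ) < y := lt_of_le_of_ne hy (Ne.symm hy1)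
      exact (hS (y / k) (by positivity)).mul_const _
  refine key.congr' ?_
  filter_upwards [eventually_ge_atTop 1] with N hN
  have hNp : (0:ℝ) < N := by exact_mod_cast hN
  have h1 := h.U_integral (x := k / N) (by positivity)
  have e1 : ∀ n : ℕ, u n * (Real.exp (-(1 / (N:ℝ))) ^ n) ^ k = u n * Real.exp (-(n * (k / N))) := by
    intro n
    rw [← Real.exp_nat_mul, ← Real.exp_nat_mul]; congr 2; field_simp
  simp_rw [e1]
  rw [h1, ← MeasureTheory.integral_div]
  congr 1; ext y
  have : y / (k / N) = y / k * N := by field_simp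
  rw [this]; ring

lemma UC (h : Rnw f u) {z : ℝ} (hz0 : 0 ≤ z) (hz : z < 1) :
    (∑' n, u n * z ^ n) * (∑' n, rnwC f (n + 1) * z ^ n) = (1 - z)⁻¹ := by
  have hg := summable_geometric_of_lt_one hz0 hz
  have s1 : Summable fun n => ‖u n * z ^ n‖ := by
    refine Summable.of_nonneg_of_le (fun _ => norm_nonneg _) (fun n => ?_) hg
    rw [Real.norm_of_nonneg (mul_nonneg (h.u_nonneg n) (by positivity))]
    exact mul_le_of_le_one_left (by positivity) (h.u_le_one n)
  have s2 : Summable fun n => ‖rnwC f (n + 1) * z ^ n‖ := by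
    refine Summable.of_nonneg_of_le (fun _ => norm_nonneg _) (fun n => ?_) hg
    rw [Real.norm_of_nonneg (mul_nonneg (h.c_nonneg _) (by positivity))]
    exact mul_le_of_le_one_left (by positivity) (h.c_le_one _)
  rw [tsum_mul_tsum_eq_tsum_sum_range_of_summable_norm s1 s2, ← tsum_geometric_of_lt_one hz0 hz]
  refine tsum_congr fun n => ?_
  conv_rhs => rw [← one_mul (z ^ n), ← h.conv_one n, Finset.sum_mul]
  refine Finset.sum_congr rfl fun k hk => ?_
  simp at hk
  have : z ^ n = z ^ k * z ^ (n - k) := by rw [← pow_add]; congr 1; omega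
  rw [this]; ring

lemma tend_exp (k : ℝ) : Tendsto (fun N : ℕ => (N:ℝ) * (1 - Real.exp (-(1 / (N:ℝ)) * k))) atTop (nhds k) := by
  have hd : HasDerivAt (fun x : ℝ => 1 - Real.exp (-x * k)) k 0 := by
    have h1 : HasDerivAt (fun x : ℝ => -x * k) (-1 * k) 0 := ((hasDerivAt_id 0).neg).mul_const k
    have := (h1.exp).const_sub 1
    simpa using this
  have h2 := hd.tendsto_slope_zero_right
  have h3 : Tendsto (fun N : ℕ => 1 / (N:ℝ)) atTop (nhdsWithin 0 (Set.Ioi 0)) := by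
    rw [tendsto_nhdsWithin_iff]
    refine ⟨tendsto_one_div_atTop_nhds_zero_nat, ?_⟩
    filter_upwards [eventually_ge_atTop 1] with N hN
    have hNp : (0:ℝ) < N := by exact_mod_cast hN
    exact one_div_pos.2 hNp
  refine (h2.comp h3).congr fun N => ?_
  simp

lemma gamma_pos (t : ℝ) (ht : 0 < t) (k : ℝ) (hk : 0 < k) :
    0 < ∫ y in Set.Ici (0:ℝ), (y / k) ^ t * Real.exp (-y) := by
  have : ∫ y in Set.Ici (0:ℝ), (y / k) ^ t * Real.exp (-y) = (k ^ t)⁻¹ * Real.Gamma (t + 1) := by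
    rw [Real.Gamma_eq_integral (by linarith), ← MeasureTheory.integral_const_mul, MeasureTheory.integral_Ici_eq_integral_Ioi]
    refine MeasureTheory.setIntegral_congr_fun measurableSet_Ioi fun y hy => ?_
    have hy0 : (0:ℝ) < y := hy
    rw [Real.div_rpow hy0.le hk.le, add_sub_cancel_right]; field_simp
  rw [this]
  have := Real.Gamma_pos_of_pos (show 0 < t + 1 by linarith)
  positivity

lemma X_tend (h : Rnw f u) (t : ℝ) (ht : 0 < t)
    (hS : ∀ l : ℝ, 0 < l → Tendsto (fun n : ℕ => rnwS u ⌊l * (n : ℝ)⌋₊ / rnwS u n) atTop (nhds (l ^ t))) :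
    ∃ κ, 1 ≤ κ ∧ Tendsto (fun N : ℕ => rnwS u N / N * rnwL f N) atTop (nhds κ) := by
  have := rnw_karamata (fun n => rnwC f (n + 1)) (fun a b hab => h.c_anti (by omega)) (fun n => h.c_nonneg _)
    (fun N => rnwS u N / N) (fun N => div_nonneg (by linarith [h.S_one_le N]) (by positivity))
    (fun k => (∫ y in Set.Ici (0:ℝ), (y / k) ^ t * Real.exp (-y))⁻¹ * (k:ℝ)⁻¹) ?_
  · obtain ⟨κ, hκ⟩ := this
    simp_rw [← L_eq] at hκ
    refine ⟨κ, ge_of_tendsto hκ ?_, hκ⟩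
    filter_upwards [eventually_ge_atTop 1] with N hN
    have hNp : (0:ℝ) < N := by exact_mod_cast hN
    rw [div_mul_eq_mul_div, one_le_div hNp]
    exact h.SL_ge' N
  · intro k hk
    have hkp : (0:ℝ) < k := by exact_mod_cast hk
    have h1 := (h.abel t hS k hk).inv₀ (gamma_pos t ht k hkp).ne'
    have h2 := (tend_exp k).inv₀ hkp.ne'
    refine (h1.mul h2).congr' ?_
    filter_upwards [eventually_ge_atTop 1] with N hN
    have hNp : (0:ℝ) < N := by exact_mod_cast hN
    set z := Real.exp (-(1 / (N:ℝ)) * k) with hz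
    have hz1 : z < 1 := by
      rw [hz, Real.exp_lt_one_iff]
      have : 0 < 1 / (N:ℝ) := by positivity
      nlinarith
    have e : ∀ n : ℕ, (Real.exp (-(1 / (N:ℝ))) ^ n) ^ k = z ^ n := by
      intro n
      rw [hz, ← pow_mul, mul_comm n k, pow_mul, ← Real.exp_nat_mul (-(1 / (N:ℝ))) k, mul_comm (k:ℝ)]
    simp_rw [e]
    have huc := h.UC (Real.exp_pos _).le hz1
    have hSN : 0 < rnwS u N := by linarith [h.S_one_le N]
    have hz2 : 0 < 1 - z := by linarith
    set UU := ∑' n, u n * z ^ n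
    set CC := ∑' n, rnwC f (n + 1) * z ^ n
    have hUU : UU ≠ 0 := by
      intro h0; rw [h0, zero_mul] at huc
      exact (inv_pos.2 hz2).ne huc
    have : CC = (1 - z)⁻¹ / UU := by rw [← huc]; field_simp
    rw [this]; field_simp

lemma L_ratio (h : Rnw f u) (t : ℝ) (ht : 0 < t)
    (hS : ∀ l : ℝ, 0 < l → Tendsto (fun n : ℕ => rnwS u ⌊l * (n : ℝ)⌋₊ / rnwS u n) atTop (nhds (l ^ t)))
    (μ : ℝ) (hμ : 0 < μ) :
    Tendsto (fun N : ℕ => rnwL f ⌊μ * (N:ℝ)⌋₊ / rnwL f N) atTop (nhds (μ ^ (1 - t))) := by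
  obtain ⟨κ, hκ1, hκ⟩ := h.X_tend t ht hS
  have hfl : Tendsto (fun N : ℕ => ⌊μ * (N:ℝ)⌋₊) atTop atTop :=
    tendsto_nat_floor_atTop.comp ((tendsto_natCast_atTop_atTop).const_mul_atTop hμ)
  have h1 := (hκ.comp hfl).div hκ (by linarith)
  have h2 : Tendsto (fun N : ℕ => (⌊μ * (N:ℝ)⌋₊ : ℝ) / N) atTop (nhds μ) :=
    (tendsto_nat_floor_mul_div_atTop hμ.le).comp tendsto_natCast_atTop_atTop
  have h3 := (hS μ hμ).inv₀ (Real.rpow_pos_of_pos hμ t).ne'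
  have h4 := (h1.mul h2).mul h3
  have e : κ / κ * μ * (μ ^ t)⁻¹ = μ ^ (1 - t) := by
    rw [div_self (by linarith), one_mul, Real.rpow_sub hμ, Real.rpow_one, div_eq_mul_inv]
  rw [e] at h4
  refine h4.congr' ?_
  filter_upwards [eventually_ge_atTop 1, hfl.eventually_ge_atTop 1] with N hN hm
  simp only [Function.comp, Pi.div_apply]
  set m := ⌊μ * (N:ℝ)⌋₊
  have hNp : (0:ℝ) < N := by exact_mod_cast hN
  have hmp : (0:ℝ) < m := by exact_mod_cast hm
  have a1 : 0 < rnwS u N := by linarith [h.S_one_le N]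
  have a2 : 0 < rnwS u m := by linarith [h.S_one_le m]
  have a3 : 0 < rnwL f N := by linarith [h.L_one_le hN]
  field_simp

lemma ratio_bound (h : Rnw f u) (t : ℝ) (ht : 0 < t)
    (hS : ∀ l : ℝ, 0 < l → Tendsto (fun n : ℕ => rnwS u ⌊l * (n : ℝ)⌋₊ / rnwS u n) atTop (nhds (l ^ t)))
    (ρ : ℝ) (hρ : 1 - t < ρ) :
    ∀ᶠ N : ℕ in atTop, N * rnwC f N / rnwL f N ≤ ρ := by
  obtain ⟨μ, hμ0, hμ1, hμ⟩ : ∃ μ : ℝ, 0 < μ ∧ μ < 1 ∧ 1 - μ ^ (1 - t) < ρ * (1 - μ) := by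
    have hd : HasDerivAt (fun x : ℝ => x ^ (1 - t)) (1 - t) 1 := by
      simpa using Real.hasDerivAt_rpow_const (x := 1) (p := 1 - t) (Or.inl one_ne_zero)
    have hs := (hasDerivAt_iff_tendsto_slope.1 hd).mono_left
      (nhdsWithin_mono 1 (show Set.Iio (1:ℝ) ⊆ {1}ᶜ from fun x hx => ne_of_lt hx))
    have h1 := hs.eventually_lt_const hρ
    obtain ⟨μ, ha, hb⟩ := (h1.and (Ioo_mem_nhdsLT (show (0:ℝ) < 1 by norm_num))).exists
    refine ⟨μ, hb.1, hb.2, ?_⟩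
    rw [slope_def_field, Real.one_rpow, ← neg_div_neg_eq, div_lt_iff₀ (by linarith [hb.2])] at ha
    linarith
  have hL := h.L_ratio t ht hS μ hμ0
  have hev := hL.eventually_const_lt (show 1 - ρ * (1 - μ) < μ ^ (1 - t) by linarith)
  filter_upwards [hev, eventually_ge_atTop 1] with N hN hN1
  set m := ⌊μ * (N:ℝ)⌋₊ with hm
  have hNp : (0:ℝ) < N := by exact_mod_cast hN1
  have hmle : (m:ℝ) ≤ μ * N := Nat.floor_le (by positivity)
  have hmN : m ≤ N := by
    have : (m:ℝ) ≤ N := by nlinarith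
    exact_mod_cast this
  have a3 : 0 < rnwL f N := by linarith [h.L_one_le hN1]
  rw [lt_div_iff₀ a3] at hN
  have hs := h.L_sub m (N - m)
  rw [Nat.add_sub_cancel' hmN, Nat.cast_sub hmN] at hs
  rw [div_le_iff₀ a3]
  have hc := h.c_nonneg N
  have h5 : (1 - μ) * (N * rnwC f N) ≤ (1 - μ) * (ρ * rnwL f N) := by nlinarith
  exact le_of_mul_le_mul_left h5 (by linarith)

end Rnw

theorem stmt13 (f u : ℕ → ℝ) (t : ℝ)
    (hf0 : f 0 = 0) (hfpos : ∀ n, 0 ≤ f n) (hfsum : HasSum f 1)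
    (hu0 : u 0 = 1)
    (hu : ∀ n, 1 ≤ n → u n = ∑ k ∈ Finset.Icc 1 n, f k * u (n - k))
    (haper : ∀ d : ℕ, (∀ n, 1 ≤ n → 0 < f n → d ∣ n) → d = 1)
    (htlo : Real.sqrt 5 / (Real.sqrt 5 + 1) < t) (hthi : t ≤ 1)
    (hreg : ∀ l : ℝ, 0 < l →
      Filter.Tendsto (fun n : ℕ => rnwA u ⌊l * (n : ℝ)⌋₊ / rnwA u n) Filter.atTop
        (nhds (l ^ t))) :
    Filter.limsup (fun N : ℕ => (N : ℝ) * rnwC f N / rnwL f N) Filter.atTop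
        < 1 / (Real.sqrt 5 + 1) ∧
      (fun n : ℕ => ∑ k ∈ Finset.Icc 1 n, |u k - u (k + 1)|)
        =o[Filter.atTop] (fun n : ℕ => rnwA u n) := by
  have h : Rnw f u := ⟨hf0, hfpos, hfsum, hu0, hu⟩
  have h5 : (2.23:ℝ) < Real.sqrt 5 := Real.lt_sqrt_of_sq_lt (by norm_num)
  have ht0 : 0 < t := lt_trans (by positivity) htlo
  -- a tends to infinity
  have hA : Tendsto (rnwA u) atTop atTop := by
    rcases tendsto_of_monotone h.A_mono with hA | ⟨l, hl⟩
    · exact hA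
    · exfalso
      have h1 := hreg 1 one_pos
      have h2 := hreg 2 two_pos
      simp only [one_mul, Nat.floor_natCast, Real.one_rpow] at h1
      have hl0 : l ≠ 0 := by
        rintro rfl
        have hle : ∀ n, rnwA u n ≤ 0 := fun n => h.A_mono.ge_of_tendsto hl n
        have hge : ∀ n, 0 ≤ rnwA u n := fun n => Finset.sum_nonneg fun k _ => h.u_nonneg k
        have h0 : ∀ n, rnwA u n = 0 := fun n => le_antisymm (hle n) (hge n)
        simp only [h0, div_zero] at h1
        exact zero_ne_one (tendsto_nhds_unique tendsto_const_nhds h1)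
      have hfl : Tendsto (fun N : ℕ => ⌊(2:ℝ) * (N:ℝ)⌋₊) atTop atTop :=
        tendsto_nat_floor_atTop.comp ((tendsto_natCast_atTop_atTop).const_mul_atTop two_pos)
      have h3 := (hl.comp hfl).div hl hl0
      rw [div_self hl0] at h3
      have h4 := tendsto_nhds_unique h2 h3
      have : (1:ℝ) < 2 ^ t := Real.one_lt_rpow (by norm_num) ht0
      linarith
  have hS : ∀ l : ℝ, 0 < l → Tendsto (fun n : ℕ => rnwS u ⌊l * (n : ℝ)⌋₊ / rnwS u n) atTop (nhds (l ^ t)) := by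
    intro l hl
    have hi : Tendsto (fun n => (rnwA u n)⁻¹) atTop (nhds 0) := tendsto_inv_atTop_zero.comp hA
    have h1 := (hi.add (hreg l hl)).div (hi.add_const 1) (by norm_num)
    simp only [zero_add, div_one] at h1
    refine h1.congr' ?_
    filter_upwards [hA.eventually_ge_atTop 1] with n hn
    have : 0 < rnwA u n := by linarith
    rw [h.S_eq, h.S_eq]
    simp only [Pi.div_apply]
    field_simp
  have hτ : 1 - t < 1 / (Real.sqrt 5 + 1) := by
    have : 1 / (Real.sqrt 5 + 1) = 1 - Real.sqrt 5 / (Real.sqrt 5 + 1) := by field_simp; ring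
    linarith
  obtain ⟨ρ, hρ1, hρ2⟩ := exists_between hτ
  have hb := h.ratio_bound t ht0 hS ρ hρ1
  constructor
  · refine lt_of_le_of_lt ?_ hρ2
    refine limsup_le_of_le ?_ hb
    refine IsBoundedUnder.isCoboundedUnder_le ⟨0, ?_⟩
    rw [eventually_map]
    exact Eventually.of_forall fun N =>
      div_nonneg (mul_nonneg (Nat.cast_nonneg N) (h.c_nonneg N)) (h.L_nonneg N)
  · obtain ⟨n0, hn0⟩ := eventually_atTop.1 (hb.and (eventually_ge_atTop 1))
    refine h.smooth haper ρ (by linarith) ?_ n0 ?_ hA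
    · refine hρ2.le.trans ?_
      rw [div_le_iff₀ (by linarith)]; linarith
    · intro N hN
      obtain ⟨h1, h2⟩ := hn0 N hN
      rwa [div_le_iff₀ (by linarith [h.L_one_le h2])] at h1
end
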